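/- arXiv:1503.03272 — 2 statements merged into one kernel-verified Lean document; each statement's English description precedes it below -/
import Mathlib

section
/- For every integer k ≥ 1, every graph G with minimum degree δ(G) ≥ 3k contains k pairwise vertex-disjoint cycles, each of length divisible by 3. -/
namespace CyclesModThree

open SimpleGraph

section Basic

variable {V : Type*}

/-- `x` and `y` are joined by a walk of `G` all of whose vertices lie in `S`. -/
def ConnIn (G : SimpleGraph V) (S : Set V) (x y : V) : Prop :=
  ∃ p : G.Walk x y, ∀ z ∈ p.support, z ∈ S

/-- The total weight of a walk. -/
def wt {G : SimpleGraph V} (w : Sym2 V → ZMod 3) {x y : V} (p : G.Walk x y) : ZMod 3 :=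
  (p.edges.map w).sum

/-- There is a path of `G` from `x` to `y` inside `S` with `l` edges and total weight `α`. -/
def PathIn (G : SimpleGraph V) (w : Sym2 V → ZMod 3) (S : Set V) (x y : V) (l : ℕ)
    (α : ZMod 3) : Prop :=
  ∃ p : G.Walk x y, p.IsPath ∧ (∀ z ∈ p.support, z ∈ S) ∧ p.length = l ∧ wt w p = α

/-- There is a cycle of `G` of total weight zero, presented as a union of two paths. -/
def HasZeroCycle (G : SimpleGraph V) (w : Sym2 V → ZMod 3) : Prop :=
  ∃ (a b : V) (S T : Set V) (l m : ℕ) (α β : ZMod 3), a ≠ b ∧ PathIn G w S a b l α ∧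
    PathIn G w T a b m β ∧ (∀ x ∈ S, x ∈ T → x = a ∨ x = b) ∧ 2 ≤ l ∧ α + β = 0

variable {G G' : SimpleGraph V} {w : Sym2 V → ZMod 3} {S T : Set V} {x y z : V}
  {l m : ℕ} {α β : ZMod 3}

@[simp] lemma wt_nil : wt w (Walk.nil : G.Walk x x) = 0 := rfl

@[simp] lemma wt_cons (h : G.Adj x y) (p : G.Walk y z) :
    wt w (Walk.cons h p) = w s(x, y) + wt w p := by simp [wt]

@[simp] lemma wt_append (p : G.Walk x y) (q : G.Walk y z) :
    wt w (p.append q) = wt w p + wt w q := by simp [wt]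

@[simp] lemma wt_reverse (p : G.Walk x y) : wt w p.reverse = wt w p := by
  simp [wt, List.sum_reverse]

lemma wt_eq_length (p : G.Walk x y) (h : ∀ e ∈ p.edges, w e = 1) : wt w p = p.length := by
  induction p with
  | nil => simp
  | cons h p ih =>
    simp only [Walk.edges_cons, List.mem_cons, forall_eq_or_imp] at h
    rw [wt_cons, ih h.2, h.1]
    simp [add_comm]

namespace ConnIn

lemma refl (h : x ∈ S) : ConnIn G S x x := ⟨Walk.nil, by simpa using h⟩

lemma left_mem (h : ConnIn G S x y) : x ∈ S := by
  obtain ⟨p, hp⟩ := h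
  exact hp _ p.start_mem_support

lemma right_mem (h : ConnIn G S x y) : y ∈ S := by
  obtain ⟨p, hp⟩ := h
  exact hp _ p.end_mem_support

lemma symm (h : ConnIn G S x y) : ConnIn G S y x := by
  obtain ⟨p, hp⟩ := h
  exact ⟨p.reverse, by simpa using hp⟩

lemma trans (h : ConnIn G S x y) (h' : ConnIn G S y z) : ConnIn G S x z := by
  obtain ⟨p, hp⟩ := h
  obtain ⟨q, hq⟩ := h'
  refine ⟨p.append q, fun t ht => ?_⟩
  rw [Walk.mem_support_append_iff] at ht
  exact ht.elim (hp t) (hq t)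

lemma of_adj (h : G.Adj x y) (hx : x ∈ S) (hy : y ∈ S) : ConnIn G S x y :=
  ⟨h.toWalk, by simp [hx, hy]⟩

lemma step (h : ConnIn G S x y) (h' : G.Adj y z) (hz : z ∈ S) : ConnIn G S x z :=
  h.trans (of_adj h' h.right_mem hz)

lemma mono (h : ConnIn G S x y) (hST : ∀ z ∈ S, z ∈ T) : ConnIn G T x y := by
  obtain ⟨p, hp⟩ := h
  exact ⟨p, fun z hz => hST z (hp z hz)⟩

/-- A set containing `x` and closed under steps of `G` inside `S` contains all of the
component of `x`. -/
lemma induct (h : ConnIn G S x y) {P : V → Prop} (hx : P x)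
    (hs : ∀ a b, P a → a ∈ S → b ∈ S → G.Adj a b → P b) : P y := by
  obtain ⟨p, hp⟩ := h
  induction p with
  | nil => exact hx
  | @cons a b c h p ih =>
    have ha := hp a (by simp)
    have hb := hp b (by simp)
    exact ih (hs _ _ hx ha hb h) fun z hz => hp z (by simp [hz])

lemma of_transfer (h : ConnIn G S x y) (hT : ∀ a ∈ S, a ∈ T)
    (hG : ∀ a b, a ∈ S → b ∈ S → G.Adj a b → G'.Adj a b) : ConnIn G' T x y :=
  h.induct (P := ConnIn G' T x) (refl (hT _ h.left_mem))
    fun a b ha haS hbS hab => ha.step (hG a b haS hbS hab) (hT _ hbS)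

/-- The walk can be confined to the component of `x` in `S`. -/
lemma confine (h : ConnIn G S x y) : ConnIn G {z | ConnIn G S x z} x y :=
  (h.induct (P := fun z => ConnIn G S x z ∧ ConnIn G {z | ConnIn G S x z} x z)
    ⟨refl h.left_mem, refl (refl h.left_mem)⟩
    fun _ _ ⟨h1, h2⟩ _ hb hab => ⟨h1.step hab hb, h2.step hab (h1.step hab hb)⟩).2

lemma exists_pathIn (h : ConnIn G S x y) : ∃ l α, PathIn G w S x y l α := by
  classical
  obtain ⟨p, hp⟩ := h
  exact ⟨_, _, p.bypass, p.bypass_isPath,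
    fun z hz => hp z (p.support_bypass_subset_support hz), rfl, rfl⟩

end ConnIn

namespace PathIn

lemma connIn (h : PathIn G w S x y l α) : ConnIn G S x y := by
  obtain ⟨p, -, hp, -⟩ := h
  exact ⟨p, hp⟩

lemma mono (h : PathIn G w S x y l α) (hST : ∀ z ∈ S, z ∈ T) : PathIn G w T x y l α := by
  obtain ⟨p, h1, hp, h2⟩ := h
  exact ⟨p, h1, fun z hz => hST z (hp z hz), h2⟩

lemma symm (h : PathIn G w S x y l α) : PathIn G w S y x l α := by
  obtain ⟨p, h1, hp, h2⟩ := h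
  exact ⟨p.reverse, h1.reverse, by simpa using hp, by simpa using h2⟩

lemma of_adj (h : G.Adj x y) : PathIn G w {x, y} x y 1 (w s(x, y)) :=
  ⟨h.toWalk, h.isPath_toWalk, by simp, by simp, by simp [Adj.toWalk]⟩

lemma trans (h : PathIn G w S x y l α) (h' : PathIn G w T y z m β)
    (hST : ∀ t ∈ S, t ∈ T → t = y) : PathIn G w (S ∪ T) x z (l + m) (α + β) := by
  obtain ⟨p, hp, hpS, rfl, rfl⟩ := h
  obtain ⟨q, hq, hqT, rfl, rfl⟩ := h'
  refine ⟨p.append q, ?_, ?_, by simp, by simp⟩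
  · rw [Walk.isPath_def, Walk.support_append, List.nodup_append']
    refine ⟨hp.support_nodup, hq.support_nodup.tail, fun t ht ht' => ?_⟩
    have := hST t (hpS t ht) (hqT t (List.mem_of_mem_tail ht'))
    subst this
    have h2 := hq.support_nodup
    rw [← Walk.cons_tail_support] at h2
    exact (List.nodup_cons.1 h2).1 ht'
  · intro t ht
    rw [Walk.mem_support_append_iff] at ht
    exact ht.elim (fun h => Or.inl (hpS t h)) (fun h => Or.inr (hqT t h))

lemma cons (h : G.Adj x y) (h' : PathIn G w T y z m β) (hx : x ∉ T) :
    PathIn G w (insert x T) x z (m + 1) (w s(x, y) + β) := by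
  obtain ⟨q, hq, hqT, rfl, rfl⟩ := h'
  refine ⟨Walk.cons h q, hq.cons fun hh => hx (hqT _ hh), ?_, by simp, by simp⟩
  intro t ht
  simp only [Walk.support_cons, List.mem_cons] at ht
  exact ht.imp id (hqT t)

end PathIn

end Basic

section Whitney

variable {V : Type*} {G G' : SimpleGraph V} {w : Sym2 V → ZMod 3} {S T L : Set V} {x y z : V}
  {l m : ℕ} {α β : ZMod 3}

/-- Follow a walk until it first meets `X`. -/
lemma ConnIn.first_hit (h : ConnIn G S x y) (X : Set V) (hy : y ∈ X) :
    ∃ z ∈ X, z ∈ S ∧ ConnIn G {t | t ∈ S ∧ (t ∈ X → t = z)} x z := by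
  have key := h.induct (P := fun b => (∃ z ∈ X, z ∈ S ∧ ConnIn G {t | t ∈ S ∧ (t ∈ X → t = z)} x z)
    ∨ (b ∉ X ∧ ConnIn G {t | t ∈ S ∧ t ∉ X} x b)) ?_ ?_
  · rcases key with h | ⟨h, -⟩
    · exact h
    · exact absurd hy h
  · by_cases hx : x ∈ X
    · exact Or.inl ⟨x, hx, h.left_mem, .refl ⟨h.left_mem, fun _ => rfl⟩⟩
    · exact Or.inr ⟨hx, .refl ⟨h.left_mem, hx⟩⟩
  · rintro a b (h | ⟨ha, h⟩) haS hbS hab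
    · exact Or.inl h
    · by_cases hb : b ∈ X
      · refine Or.inl ⟨b, hb, hbS,
          ConnIn.step (h.mono fun t ht => ⟨ht.1, fun h => absurd h ht.2⟩) hab
          ⟨hbS, fun _ => rfl⟩⟩
      · exact Or.inr ⟨hb, (h.mono fun t ht => ht).step hab ⟨hbS, hb⟩⟩

namespace PathIn

lemma left_mem (h : PathIn G w S x y l α) : x ∈ S := h.connIn.left_mem

lemma right_mem (h : PathIn G w S x y l α) : y ∈ S := h.connIn.right_mem

lemma pos (h : PathIn G w S x y l α) (hxy : x ≠ y) : 1 ≤ l := by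
  obtain ⟨p, -, -, rfl, -⟩ := h
  by_contra! hh
  exact hxy (Walk.eq_of_length_eq_zero (p := p) (by omega))

/-- A path can be split at each vertex of its support. -/
lemma exists_splitting (h : PathIn G w S x y l α) :
    ∃ S', (∀ t ∈ S', t ∈ S) ∧ PathIn G w S' x y l α ∧ ∀ b ∈ S', ∃ S₁ S₂ l₁ l₂ α₁ α₂,
      PathIn G w S₁ x b l₁ α₁ ∧ PathIn G w S₂ b y l₂ α₂ ∧ (∀ t ∈ S₁, t ∈ S') ∧
      (∀ t ∈ S₂, t ∈ S') ∧ (∀ t ∈ S₁, t ∈ S₂ → t = b) ∧ l₁ + l₂ = l ∧ α₁ + α₂ = α := by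
  classical
  obtain ⟨p, hp, hpS, rfl, rfl⟩ := h
  refine ⟨{t | t ∈ p.support}, hpS, ⟨p, hp, fun _ h => h, rfl, rfl⟩, fun b hb => ?_⟩
  refine ⟨{t | t ∈ (p.takeUntil b hb).support}, {t | t ∈ (p.dropUntil b hb).support}, _, _, _, _,
    ⟨_, hp.takeUntil hb, fun _ h => h, rfl, rfl⟩, ⟨_, hp.dropUntil hb, fun _ h => h, rfl, rfl⟩,
    fun t ht => p.support_takeUntil_subset_support hb ht,
    fun t ht => p.support_dropUntil_subset_support hb ht, ?_, ?_, ?_⟩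
  · intro t ht ht'
    by_contra hne
    have hp' := hp
    rw [← p.take_spec hb] at hp'
    exact hp'.ne_of_mem_support_of_append hne ht ht' rfl
  · rw [← Walk.length_append, p.take_spec hb]
  · rw [← wt_append, p.take_spec hb]

end PathIn

/-- Two internally disjoint paths inside `L`, the first of length at least two. -/
def TwoPaths (G : SimpleGraph V) (w : Sym2 V → ZMod 3) (L : Set V) (a b : V) : Prop :=
  ∃ (S T : Set V) (l m : ℕ) (α β : ZMod 3), PathIn G w S a b l α ∧
    PathIn G w T a b m β ∧ (∀ x ∈ S, x ∈ T → x = a ∨ x = b) ∧ 2 ≤ l ∧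
    (∀ x ∈ S, x ∈ L) ∧ (∀ x ∈ T, x ∈ L)

lemma TwoPaths.symm_of_splitting {a b c : V} {S₁ S₂ : Set V} {l₁ l₂ : ℕ} {α₁ α₂ : ZMod 3}
    (h₁ : PathIn G w S₁ a c l₁ α₁) (h₂ : PathIn G w S₂ c b l₂ α₂) (hT : PathIn G w T a b m β)
    (h₁₂ : ∀ x ∈ S₁, x ∈ S₂ → x = c) (h₁T : ∀ x ∈ S₁, x ∈ T → x = a ∨ x = b)
    (h₂T : ∀ x ∈ S₂, x ∈ T → x = a ∨ x = b) (h₁L : ∀ x ∈ S₁, x ∈ L) (h₂L : ∀ x ∈ S₂, x ∈ L)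
    (hTL : ∀ x ∈ T, x ∈ L) (hab : a ≠ b) (hac : a ≠ c) (hbc : b ≠ c) : TwoPaths G w L a c := by
  have ha := h₁.left_mem
  have hb := h₂.right_mem
  have := hT.pos hab
  have := h₂.pos hbc.symm
  refine ⟨T ∪ S₂, S₁, _, _, _, _, hT.trans h₂.symm ?_, h₁, ?_, by omega, ?_, h₁L⟩
  · grind
  · grind
  · grind

lemma twoPaths_of_adj {a b c x : V} {S₁ R : Set V} {l₁ l₂ : ℕ} {α₁ α₂ : ZMod 3}
    (h₁ : PathIn G w S₁ a x l₁ α₁) (hR : PathIn G w R x c l₂ α₂) (hT : PathIn G w T a b m β)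
    (h₁R : ∀ t ∈ S₁, t ∈ R → t = x) (h₁T : ∀ t ∈ S₁, t ∈ T → t = a)
    (hRT : ∀ t ∈ R, t ∈ T → t = x) (h₁L : ∀ t ∈ S₁, t ∈ L) (hRL : ∀ t ∈ R, t ∈ L)
    (hTL : ∀ t ∈ T, t ∈ L) (hab : a ≠ b) (hcT : c ∉ T) (hbc : G.Adj b c) :
    TwoPaths G w L a c := by
  have := hT.pos hab
  have hcR := hR.right_mem
  have hx := h₁.right_mem
  refine ⟨T ∪ {b, c}, S₁ ∪ R, _, _, _, _, hT.trans (.of_adj hbc) ?_, h₁.trans hR h₁R,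
    ?_, by omega, ?_, ?_⟩
  · intro t ht ht'
    simp only [Set.mem_insert_iff, Set.mem_singleton_iff] at ht'
    rcases ht' with rfl | rfl
    · rfl
    · exact absurd ht hcT
  · have := hT.right_mem
    intro t ht ht'
    simp only [Set.mem_insert_iff, Set.mem_singleton_iff, Set.mem_union] at ht ht'
    have hb : b ∈ S₁ → b = a := fun h => h₁T b h this
    rcases ht with ht | rfl | rfl
    · rcases ht' with h | h
      · exact Or.inl (h₁T _ h ht)
      · have := hRT t h ht
        subst this
        exact Or.inl (h₁T _ hx ht)
    · rcases ht' with h | h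
      · exact Or.inl (hb h)
      · have := hRT _ h this
        subst this
        exact Or.inl (hb hx)
    · exact Or.inr rfl
  · intro t ht
    simp only [Set.mem_insert_iff, Set.mem_singleton_iff, Set.mem_union] at ht
    rcases ht with ht | rfl | rfl
    · exact hTL _ ht
    · exact hTL _ hT.right_mem
    · exact hRL _ hcR
  · rintro t (h | h)
    exacts [h₁L _ h, hRL _ h]

/-- In a set `L` with at least three vertices which stays connected after deleting any one of its
vertices, any two vertices are joined by two internally disjoint paths. -/
theorem twoPaths_of_connected (hL : ∀ s ∈ L, ∀ x ∈ L, ∀ y ∈ L, x ≠ s → y ≠ s →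
      ConnIn G {t | t ∈ L ∧ t ≠ s} x y)
    (h3 : ∀ a b, ∃ c ∈ L, c ≠ a ∧ c ≠ b) {a b : V} (ha : a ∈ L) (hb : b ∈ L) (hab : a ≠ b) :
    TwoPaths G w L a b := by
  obtain ⟨c, hc, hca, hcb⟩ := h3 a b
  have h := hL c hc a ha b hb hca.symm hcb.symm
  refine h.induct (P := fun z => z ≠ a → TwoPaths G w L a z) (fun h => absurd rfl h) ?_ hab.symm
  intro b' b ih hb' hb hadj hba
  replace hb' := hb'.1
  replace hb := hb.1
  by_cases hb'a : b' = a
  · subst hb'a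
    obtain ⟨c, hc, hca, hcb⟩ := h3 b' b
    obtain ⟨p, hp⟩ := hL b hb b' ha c hc hba.symm hcb
    cases p with
    | nil => exact absurd rfl hca
    | @cons _ d _ h p =>
      have hd := hp d (by simp)
      obtain ⟨l, α, hR⟩ := (hL b' ha d hd.1 b hb h.ne.symm hba).exists_pathIn (w := w)
      have := hR.pos hd.2
      refine ⟨_, _, _, _, _, _, hR.cons h (fun h => h.2 rfl), .of_adj hadj, ?_, by omega, ?_, ?_⟩
      · intro x _ hx
        simpa using hx
      · intro x hx
        rcases hx with rfl | hx
        exacts [ha, hx.1]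
      · intro x hx
        rcases hx with rfl | rfl
        exacts [ha, hb]
  obtain ⟨S, T, l, m, α, β, hS, hT, hST, -, hSL, hTL⟩ := ih hb'a
  obtain ⟨S, hSS, hS, hSsp⟩ := hS.exists_splitting
  obtain ⟨T, hTT, hT, hTsp⟩ := hT.exists_splitting
  replace hST : ∀ x ∈ S, x ∈ T → x = a ∨ x = b' := fun x h h' => hST x (hSS x h) (hTT x h')
  replace hSL : ∀ x ∈ S, x ∈ L := fun x h => hSL x (hSS x h)
  replace hTL : ∀ x ∈ T, x ∈ L := fun x h => hTL x (hTT x h)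
  have hne := hadj.ne
  by_cases hbS : b ∈ S
  · obtain ⟨S₁, S₂, l₁, l₂, α₁, α₂, h₁, h₂, h₁S, h₂S, h₁₂, -⟩ := hSsp b hbS
    exact TwoPaths.symm_of_splitting h₁ h₂ hT h₁₂ (fun x h => hST x (h₁S x h))
      (fun x h => hST x (h₂S x h)) (fun x h => hSL x (h₁S x h)) (fun x h => hSL x (h₂S x h)) hTL
      (Ne.symm hb'a) hba.symm hne
  by_cases hbT : b ∈ T
  · obtain ⟨S₁, S₂, l₁, l₂, α₁, α₂, h₁, h₂, h₁S, h₂S, h₁₂, -⟩ := hTsp b hbT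
    exact TwoPaths.symm_of_splitting h₁ h₂ hS h₁₂ (fun x h h' => hST x h' (h₁S x h))
      (fun x h h' => hST x h' (h₂S x h)) (fun x h => hTL x (h₁S x h)) (fun x h => hTL x (h₂S x h))
      hSL (Ne.symm hb'a) hba.symm hne
  obtain ⟨x, hx, hxL, hR⟩ := (hL b' hb' b hb a ha hne.symm (Ne.symm hb'a)).first_hit (S ∪ T)
    (Or.inl hS.left_mem)
  obtain ⟨lr, αr, hR⟩ := hR.symm.exists_pathIn (w := w)
  rcases hx with hx | hx
  · obtain ⟨S₁, S₂, l₁, l₂, α₁, α₂, h₁, h₂, h₁S, h₂S, h₁₂, -⟩ := hSsp x hx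
    refine twoPaths_of_adj h₁ hR hT (fun t h h' => h'.2 (Or.inl (h₁S t h))) ?_
      (fun t h h' => h.2 (Or.inr h')) (fun x h => hSL x (h₁S x h)) (fun x h => h.1.1) hTL
      (Ne.symm hb'a) hbT hadj
    intro t ht ht'
    rcases hST t (h₁S t ht) ht' with h | rfl
    · exact h
    · exact absurd (h₁₂ _ ht h₂.right_mem).symm hxL.2
  · obtain ⟨S₁, S₂, l₁, l₂, α₁, α₂, h₁, h₂, h₁S, h₂S, h₁₂, -⟩ := hTsp x hx
    refine twoPaths_of_adj h₁ hR hS (fun t h h' => h'.2 (Or.inr (h₁S t h))) ?_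
      (fun t h h' => h.2 (Or.inl h')) (fun x h => hTL x (h₁S x h)) (fun x h => h.1.1) hSL
      (Ne.symm hb'a) hbS hadj
    intro t ht ht'
    rcases hST t ht' (h₁S t ht) with h | rfl
    · exact h
    · exact absurd (h₁₂ _ ht h₂.right_mem).symm hxL.2

end Whitney

section Nonseparating

variable {V : Type*} {K : SimpleGraph V}

/-- No two vertices `l, r` separate the graph: a nonempty set whose outer neighbours are all among
`l, r` covers all the other vertices. -/
def NoTwoCut (K : SimpleGraph V) : Prop :=
  ∀ Q : Set V, Q.Nonempty → ∀ l r, (∀ q ∈ Q, ∀ y, K.Adj q y → y ∈ Q ∨ y = l ∨ y = r) →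
    ∀ x, x ∈ Q ∨ x = l ∨ x = r

lemma connIn_getVert {a b : V} (P : K.Walk a b) (i j : ℕ) (hij : i ≤ j) :
    ConnIn K {t | ∃ n, i ≤ n ∧ n ≤ j ∧ P.getVert n = t} (P.getVert i) (P.getVert j) := by
  induction j, hij using Nat.le_induction with
  | base => exact .refl ⟨i, le_rfl, le_rfl, rfl⟩
  | succ j hij ih =>
    have h1 : ConnIn K {t | ∃ n, i ≤ n ∧ n ≤ j + 1 ∧ P.getVert n = t} (P.getVert i)
        (P.getVert j) := ih.mono fun t ⟨n, h1, h2, h3⟩ => ⟨n, h1, by omega, h3⟩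
    by_cases hj : j < P.length
    · exact h1.step (P.adj_getVert_succ hj) ⟨j + 1, by omega, le_rfl, rfl⟩
    · rwa [show P.getVert (j + 1) = P.getVert j by
        rw [P.getVert_of_length_le (by omega), P.getVert_of_length_le (by omega)]]

/-- A path joining the ends of an edge `ab`, avoiding a connected set `X`, whose complement is
connected and dominates it. -/
theorem exists_nonseparating_path [Finite V] (hK : NoTwoCut K) {a b : V}
    (X : Set V) {x₀ : V} (hx₀ : x₀ ∈ X) (hX : ∀ x ∈ X, ConnIn K X x₀ x)
    (hab : ConnIn (K.deleteEdges {s(a, b)}) Xᶜ a b) :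
    ∃ P : (K.deleteEdges {s(a, b)}).Walk a b, P.IsPath ∧ (∀ x ∈ P.support, x ∉ X) ∧
      (∀ y z, y ∉ P.support → z ∉ P.support → ConnIn K {t | t ∉ P.support} y z) ∧
      ∀ d ∈ P.support, ∃ h, h ∉ P.support ∧ K.Adj d h := by
  classical
  set K' := K.deleteEdges {s(a, b)} with hK'
  have hle : ∀ {x y}, K'.Adj x y → K.Adj x y := fun h => (K.deleteEdges_adj.1 h).1
  have hadj : ∀ {x y}, K.Adj x y → K'.Adj x y ∨ (x = a ∧ y = b) ∨ (x = b ∧ y = a) := by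
    intro x y h
    by_cases hh : s(x, y) = s(a, b)
    · exact Or.inr (by simpa using hh)
    · exact Or.inl (K.deleteEdges_adj.2 ⟨h, hh⟩)
  have hpath : ∀ S : Set V, ConnIn K' S a b → ∃ P : K'.Walk a b,
      P.IsPath ∧ ∀ z ∈ P.support, z ∈ S := fun S ⟨p, hp⟩ =>
    ⟨p.bypass, p.bypass_isPath, fun z hz => hp z (p.support_bypass_subset_support hz)⟩
  let H : K'.Walk a b → Set V := fun P => {y | ConnIn K {t | t ∉ P.support} x₀ y}
  obtain ⟨P, ⟨hP, hPX⟩, hmax⟩ :=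
    (measure fun P : K'.Walk a b => Nat.card V - (H P).ncard).wf.has_min
    {P | P.IsPath ∧ ∀ z ∈ P.support, z ∉ X} (hpath _ hab)
  have hXH : ∀ x ∈ X, x ∈ H P := fun x hx => (hX x hx).mono fun t ht h => hPX t h ht
  have hHP : ∀ x ∈ H P, x ∉ P.support := fun x hx => hx.right_mem
  have hstep : ∀ x ∈ H P, ∀ y, K.Adj x y → y ∉ H P → y ∈ P.support := by
    intro x hx y hxy hy
    by_contra h
    exact hy (ConnIn.step hx hxy h)
  -- every path avoiding the component of `x₀` runs through all its neighbours
  have hkey : ∀ s h, h ∈ H P → K.Adj h s → s ∉ H P → ¬ ConnIn K' {t | t ∉ H P ∧ t ≠ s} a b := by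
    intro s h hh hhs hs hconn
    obtain ⟨P', hP', hP'S⟩ := hpath _ hconn
    have hsub : ∀ y ∈ H P, y ∈ H P' := by
      intro y hy
      exact (ConnIn.confine hy).mono fun t ht ht' => (hP'S t ht').1 ht
    have hs' : s ∈ H P' := ConnIn.step (hsub h hh) hhs fun hs => (hP'S s hs).2 rfl
    have hlt : (H P).ncard < (H P').ncard :=
      Set.ncard_lt_ncard ⟨hsub, fun hh => hs (hh hs')⟩ (Set.toFinite _)
    have hle : (H P').ncard ≤ Nat.card V := Set.ncard_le_card _
    refine hmax P' ⟨hP', fun z hz hzX => (hP'S z hz).1 (hXH z hzX)⟩ ?_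
    show Nat.card V - (H P').ncard < Nat.card V - (H P).ncard
    omega
  have hmain : ∀ w, w ∉ H P → ∃ h ∈ H P, K.Adj h w := by
    intro w hw
    by_contra hwA
    set B : Set V := {t | t ∉ H P ∧ ¬ ∃ h ∈ H P, K.Adj h t} with hB
    set Q : Set V := {y | ConnIn K' B w y} with hQ
    have hwQ : w ∈ Q := ConnIn.refl ⟨hw, hwA⟩
    have hQB : ∀ q ∈ Q, q ∈ B := fun q hq => hq.right_mem
    have hNQ : ∀ q ∈ Q, ∀ y, K'.Adj q y → y ∉ Q → y ∉ H P ∧ ∃ h ∈ H P, K.Adj h y := by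
      intro q hq y hqy hy
      have h1 : y ∉ H P := fun h => (hQB q hq).2 ⟨y, h, (hle hqy).symm⟩
      refine ⟨h1, ?_⟩
      by_contra h2
      exact hy (ConnIn.step hq hqy ⟨h1, h2⟩)
    have hx₀Q : x₀ ∉ Q := fun h => (hQB _ h).1 (hXH _ hx₀)
    have haP : a ∈ P.support := P.start_mem_support
    have hbP : b ∈ P.support := P.end_mem_support
    have hx₀P : x₀ ∉ P.support := hHP _ (hXH _ hx₀)
    have hend : ∀ l r, l ∈ P.support → r ∈ P.support →
        (∀ q ∈ Q, ∀ y, K.Adj q y → y ∈ Q ∨ y = l ∨ y = r) → False := by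
      intro l r hl hr h
      rcases hK Q ⟨w, hwQ⟩ l r h x₀ with h | rfl | rfl
      exacts [hx₀Q h, hx₀P hl, hx₀P hr]
    let J : Set ℕ := {i | i ≤ P.length ∧ (P.getVert i ∈ Q ∨ ∃ q ∈ Q, K'.Adj q (P.getVert i))}
    have hJfin : J.Finite := (Set.finite_Iic P.length).subset fun i hi => hi.1
    have hPget : ∀ y ∈ P.support, ∃ i ≤ P.length, P.getVert i = y := by
      intro y hy
      obtain ⟨i, h1, h2⟩ := Walk.mem_support_iff_exists_getVert.1 hy
      exact ⟨i, h2, h1⟩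
    by_cases hJ : J.Nonempty
    · obtain ⟨i₀, hi₀, hmin⟩ := hJfin.exists_minimal hJ
      obtain ⟨i₁, hi₁, hmax'⟩ := hJfin.exists_maximal hJ
      replace hmin : ∀ j ∈ J, i₀ ≤ j := fun j hj => by
        by_contra h; exact h (hmin hj (by omega))
      replace hmax' : ∀ j ∈ J, j ≤ i₁ := fun j hj => by
        by_contra h; exact h (hmax' hj (by omega))
      have hN' : ∀ q ∈ Q, ∀ y, K'.Adj q y → y ∈ Q ∨ y = P.getVert i₀ ∨ y = P.getVert i₁ := by
        intro q hq y hqy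
        by_contra! hcon
        obtain ⟨hyH, h, hh, hhy⟩ := hNQ q hq y hqy hcon.1
        have hyP := hstep h hh y hhy hyH
        obtain ⟨n, hn, rfl⟩ := hPget y hyP
        have hnJ : n ∈ J := ⟨hn, Or.inr ⟨q, hq, hqy⟩⟩
        have h0 := hmin n hnJ
        have h1 := hmax' n hnJ
        have hn0 : n ≠ i₀ := by rintro rfl; exact hcon.2.1 rfl
        have hn1 : n ≠ i₁ := by rintro rfl; exact hcon.2.2 rfl
        have hseg : ∀ j ≤ P.length, j ≠ n → P.getVert j ∈ {t | t ∉ H P ∧ t ≠ P.getVert n} := by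
          intro j hj hjn
          refine ⟨fun hh => hHP _ hh (P.getVert_mem_support j), fun hh => hjn ?_⟩
          exact hP.getVert_injOn hj hn hh
        refine hkey _ h hh hhy hyH ?_
        have c1 : ConnIn K' {t | t ∉ H P ∧ t ≠ P.getVert n} a (P.getVert i₀) := by
          have := connIn_getVert P 0 i₀ (by omega)
          rw [P.getVert_zero] at this
          refine this.mono ?_
          rintro t ⟨j, -, hj, rfl⟩
          exact hseg j (by omega) (by omega)
        have c3 : ConnIn K' {t | t ∉ H P ∧ t ≠ P.getVert n} (P.getVert i₁) b := by
          have := connIn_getVert P i₁ P.length hi₁.1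
          rw [P.getVert_length] at this
          refine this.mono ?_
          rintro t ⟨j, hj, hj', rfl⟩
          exact hseg j (by omega) (by omega)
        have hwi : ∀ i ∈ J, i ≠ n → ConnIn K' {t | t ∉ H P ∧ t ≠ P.getVert n} w (P.getVert i) := by
          have hBsub : ∀ t ∈ B, t ∈ {t | t ∉ H P ∧ t ≠ P.getVert n} := by
            rintro t ⟨h1, h2⟩
            refine ⟨h1, ?_⟩
            rintro rfl
            exact h2 ⟨h, hh, hhy⟩
          rintro i ⟨hi, hQ | ⟨q', hq', hadj'⟩⟩ hin
          · exact hQ.mono hBsub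
          · exact (hq'.mono hBsub).step hadj' (hseg i hi hin)
        exact (c1.trans (hwi i₀ hi₀ hn0.symm).symm).trans ((hwi i₁ hi₁ hn1.symm).trans c3)
      have ha0 : a ∈ Q → P.getVert i₀ = a := by
        intro h
        have : i₀ ≤ 0 := hmin 0 ⟨by omega, Or.inl (by simpa using h)⟩
        rw [Nat.le_zero.1 this, P.getVert_zero]
      have hb1 : b ∈ Q → P.getVert i₁ = b := by
        intro h
        have h1 : P.length ≤ i₁ := hmax' P.length ⟨le_rfl, Or.inl (by simpa using h)⟩
        rw [P.getVert_of_length_le h1]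
      refine hend (if a ∈ Q then b else P.getVert i₀) (if b ∈ Q then a else P.getVert i₁) ?_ ?_ ?_
      · split_ifs
        exacts [hbP, P.getVert_mem_support _]
      · split_ifs
        exacts [haP, P.getVert_mem_support _]
      · intro q hq y hqy
        rcases hadj hqy with h | ⟨rfl, rfl⟩ | ⟨rfl, rfl⟩
        · rcases hN' q hq y h with h | h | h
          · exact Or.inl h
          · by_cases haQ : a ∈ Q
            · rw [h, ha0 haQ]; exact Or.inl haQ
            · simp [haQ, h]
          · by_cases hbQ : b ∈ Q
            · rw [h, hb1 hbQ]; exact Or.inl hbQ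
            · simp [hbQ, h]
        · simp [hq]
        · simp [hq]
    · have hno : ∀ y ∈ P.support, y ∉ Q ∧ ∀ q ∈ Q, ¬ K'.Adj q y := by
        intro y hy
        obtain ⟨n, hn, rfl⟩ := hPget y hy
        constructor
        · exact fun h => hJ ⟨n, hn, Or.inl h⟩
        · exact fun q hq h => hJ ⟨n, hn, Or.inr ⟨q, hq, h⟩⟩
      refine hend a a haP haP fun q hq y hqy => ?_
      rcases hadj hqy with h | ⟨rfl, rfl⟩ | ⟨rfl, rfl⟩
      · left
        by_contra hy
        obtain ⟨hyH, h', hh, hhy⟩ := hNQ q hq y h hy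
        exact (hno y (hstep h' hh y hhy hyH)).2 q hq h
      · exact absurd hq (hno _ haP).1
      · exact absurd hq (hno _ hbP).1
  have hcompl : ∀ y, y ∉ P.support → y ∈ H P := by
    intro y hy
    by_contra h
    obtain ⟨h', hh', hadj'⟩ := hmain y h
    exact hy (hstep h' hh' y hadj' h)
  refine ⟨P, hP, hPX, fun y z hy hz => (ConnIn.symm (hcompl y hy)).trans (hcompl z hz), ?_⟩
  intro d hd
  obtain ⟨h, hh, hadj'⟩ := hmain d fun h => hHP d h hd
  exact ⟨h, hHP h hh, hadj'.symm⟩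

end Nonseparating

section Ears

variable {V : Type*} {K : SimpleGraph V} {w : Sym2 V → ZMod 3} {c : ℕ → V} {m : ℕ}

lemma pathIn_arc (hc : ∀ i j, c i = c j ↔ i ≡ j [MOD m]) (hadj : ∀ n, K.Adj (c n) (c (n + 1)))
    (hw : ∀ n, w s(c n, c (n + 1)) = 1) (i d : ℕ) (hd : d < m) :
    PathIn K w {t | ∃ n, i ≤ n ∧ n ≤ i + d ∧ c n = t} (c i) (c (i + d)) d d := by
  induction d with
  | zero => exact ⟨Walk.nil, Walk.IsPath.nil, by simpa using ⟨i, le_rfl, le_rfl, rfl⟩, rfl, by simp⟩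
  | succ d ih =>
    have h1 := (ih (by omega)).trans (.of_adj (hadj (i + d)) (w := w)) ?_
    · rw [hw] at h1
      push_cast
      refine h1.mono ?_
      rintro t (⟨n, h1, h2, rfl⟩ | rfl | rfl)
      exacts [⟨n, h1, by omega, rfl⟩, ⟨i + d, by omega, by omega, rfl⟩,
        ⟨i + (d + 1), by omega, by omega, rfl⟩]
    · rintro t ⟨n, h1, h2, rfl⟩ (h | h)
      · exact h
      · rw [Set.mem_singleton_iff, hc] at h
        have := Nat.ModEq.dvd h
        have h3 := Int.le_of_dvd (by push_cast; omega) this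
        push_cast at h3
        omega

/-- Weights of ears on a cycle of length two modulo three. -/
lemma ear_weight (hZ : ¬ HasZeroCycle K w)
    (hc : ∀ i j, c i = c j ↔ i ≡ j [MOD m]) (hadj : ∀ n, K.Adj (c n) (c (n + 1)))
    (hw : ∀ n, w s(c n, c (n + 1)) = 1) (hm : m % 3 = 2) {E : Set V} {i d l : ℕ} {α : ZMod 3}
    (h0 : 0 < d) (hd : d < m) (hE : PathIn K w E (c i) (c (i + d)) l α)
    (hE' : ∀ n, c n ∈ E → c n = c i ∨ c n = c (i + d)) (hl : 2 ≤ l) :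
    (d % 3 = 1 → α ≠ 2) ∧ (d % 3 ≠ 1 → α = 2) := by
  have hne : c i ≠ c (i + d) := by
    intro h
    rw [hc] at h
    have := Int.le_of_dvd (by push_cast; omega) (Nat.ModEq.dvd h)
    push_cast at this
    omega
  have hper : c (i + d + (m - d)) = c i := by
    rw [hc, show i + d + (m - d) = i + m by omega]
    simp [Nat.ModEq]
  have h1 : α + (d : ZMod 3) ≠ 0 := by
    intro h
    refine hZ ⟨_, _, _, _, _, _, _, _, hne, hE, pathIn_arc hc hadj hw i d hd, ?_, hl, h⟩
    rintro x hx ⟨n, -, -, rfl⟩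
    exact hE' n hx
  have h2 : α + ((m - d : ℕ) : ZMod 3) ≠ 0 := by
    intro h
    have := pathIn_arc hc hadj hw (i + d) (m - d) (by omega)
    rw [hper] at this
    refine hZ ⟨_, _, _, _, _, _, _, _, hne, hE, this.symm, ?_, hl, h⟩
    rintro x hx ⟨n, -, -, rfl⟩
    exact hE' n hx
  have e1 : (d : ZMod 3) = ((d % 3 : ℕ) : ZMod 3) := by simp
  have e2 : ((m - d : ℕ) : ZMod 3) = (((m - d) % 3 : ℕ) : ZMod 3) := by simp
  have e3 : (m - d) % 3 = (5 - d % 3) % 3 := by omega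
  rw [e1] at h1
  rw [e2, e3] at h2
  have : d % 3 < 3 := Nat.mod_lt _ (by norm_num)
  generalize d % 3 = r at *
  clear hE hE' e1 e2 e3 hZ
  interval_cases r <;> revert α <;> decide

lemma exists_shift (hc : ∀ i j, c i = c j ↔ i ≡ j [MOD m]) (hm : 0 < m) {i j : ℕ}
    (hij : c i ≠ c j) : ∃ d, 0 < d ∧ d < m ∧ c j = c (i + d) := by
  obtain ⟨k, rfl⟩ : ∃ k, m = k + 1 := ⟨m - 1, by omega⟩
  have : c j = c (i + (j + k * i) % (k + 1)) := by
    rw [hc]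
    have h : i + (j + k * i) % (k + 1) ≡ i + (j + k * i) [MOD (k + 1)] :=
      (Nat.ModEq.refl i).add (Nat.mod_modEq _ _)
    refine Nat.ModEq.trans ?_ h.symm
    rw [show i + (j + k * i) = j + (k + 1) * i by ring]
    simp [Nat.ModEq]
  refine ⟨_, ?_, Nat.mod_lt _ hm, this⟩
  rw [Nat.pos_iff_ne_zero]
  intro h
  rw [h] at this
  exact hij this.symm

/-- A smallest nonempty `Y ⊆ H` avoiding `z` whose neighbours in `H` outside `Y` reduce to one
vertex `t` has the property that no vertex separates `Y ∪ {t}`. -/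
lemma exists_end [Finite V] {H : Set V} {z z' : V} (hz : z ∈ H) (hz' : z' ∈ H) (hzz : z' ≠ z) :
    ∃ (Y : Set V) (t : V), Y.Nonempty ∧ (∀ y ∈ Y, y ∈ H) ∧ z ∉ Y ∧ t ∈ H ∧ t ∉ Y ∧
      (∀ y ∈ Y, ∀ h ∈ H, K.Adj y h → h ∈ Y ∨ h = t) ∧
      ∀ s ∈ insert t Y, ∀ x ∈ insert t Y, ∀ y ∈ insert t Y, x ≠ s → y ≠ s →
        ConnIn K {u | u ∈ insert t Y ∧ u ≠ s} x y := by
  let IsEnd : Set V → Prop := fun Y => Y.Nonempty ∧ (∀ y ∈ Y, y ∈ H) ∧ z ∉ Y ∧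
    ∃ t, t ∈ H ∧ t ∉ Y ∧ (∀ y ∈ Y, ∀ h ∈ H, K.Adj y h → h ∈ Y ∨ h = t)
  obtain ⟨Y, ⟨hne, hYH, hzY, t, htH, htY, hN⟩, hmin⟩ :=
    (measure fun Y : Set V => Y.ncard).wf.has_min {Y | IsEnd Y}
      ⟨{y | y ∈ H ∧ y ≠ z}, ⟨z', hz', hzz⟩, fun y h => h.1, fun h => h.2 rfl, z, hz,
        fun h => h.2 rfl, fun y _ h hh _ => by
          by_cases h = z
          · right; assumption
          · left; exact ⟨hh, by assumption⟩⟩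
  replace hmin : ∀ Y', IsEnd Y' → (∀ y ∈ Y', y ∈ Y) → ∀ y ∈ Y, y ∈ Y' := by
    intro Y' h hsub y hy
    by_contra hy'
    exact hmin Y' h (Set.ncard_lt_ncard ⟨hsub, fun hh => hy' (hh hy)⟩ (Set.toFinite _))
  refine ⟨Y, t, hne, hYH, hzY, htH, htY, hN, ?_⟩
  intro s hs x hx y hy hxs hys
  by_cases hst : s = t
  · subst hst
    replace hx := Set.mem_of_mem_insert_of_ne hx hxs
    replace hy := Set.mem_of_mem_insert_of_ne hy hys
    have := hmin {u | ConnIn K Y x u} ⟨⟨x, .refl hx⟩, fun y h => hYH y h.right_mem,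
      fun h => hzY h.right_mem, s, htH, fun h => htY h.right_mem, fun u hu h hh hadj => ?_⟩
      (fun y h => h.right_mem) y hy
    · refine ConnIn.mono this fun u hu => ⟨Or.inr hu, ?_⟩
      rintro rfl
      exact htY hu
    · rcases hN u hu.right_mem h hh hadj with h1 | h1
      · exact Or.inl (ConnIn.step hu hadj h1)
      · exact Or.inr h1
  · replace hs := Set.mem_of_mem_insert_of_ne hs hst
    have key : ∀ x ∈ insert t Y, x ≠ s → ConnIn K {u | u ∈ insert t Y ∧ u ≠ s} x t := by
      intro x hx hxs
      by_contra hcon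
      have hsub : ∀ u, ConnIn K {u | u ∈ insert t Y ∧ u ≠ s} x u → u ∈ Y ∧ u ≠ s := by
        intro u hu
        refine ⟨Set.mem_of_mem_insert_of_ne hu.right_mem.1 ?_, hu.right_mem.2⟩
        rintro rfl
        exact hcon hu
      have := hmin {u | ConnIn K {u | u ∈ insert t Y ∧ u ≠ s} x u} ⟨⟨x, .refl ⟨hx, hxs⟩⟩,
        fun u hu => hYH u (hsub u hu).1, fun h => hzY (hsub z h).1, s, hYH s hs,
        fun h => (hsub s h).2 rfl, fun u hu h hh hadj => ?_⟩ (fun u hu => (hsub u hu).1) s hs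
      · exact (hsub s this).2 rfl
      · by_cases hhs : h = s
        · exact Or.inr hhs
        · refine Or.inl (ConnIn.step hu hadj ⟨?_, hhs⟩)
          rcases hN u (hsub u hu).1 h hh hadj with h1 | h1
          · exact Or.inr h1
          · exact Or.inl h1
    exact (key x hx hxs).trans (key y hy hys).symm

end Ears

section NonseparatingCycle

variable {V : Type*} {K : SimpleGraph V} {w : Sym2 V → ZMod 3} {c : ℕ → V} {m : ℕ}

/-- In a graph without 2-vertex-cuts and without zero cycles, an induced nonseparating cycle with
unit weights around it does not have length two modulo three. -/
theorem nonseparating_cycle_length [Finite V] (hK : NoTwoCut K) (hZ : ¬ HasZeroCycle K w)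
    (hm : 3 ≤ m) (hc : ∀ i j, c i = c j ↔ i ≡ j [MOD m]) (hadj : ∀ n, K.Adj (c n) (c (n + 1)))
    (hw : ∀ n, w s(c n, c (n + 1)) = 1)
    (hH : ∀ x y, x ∉ Set.range c → y ∉ Set.range c → ConnIn K {t | t ∉ Set.range c} x y)
    (hdom : ∀ n, ∃ h, h ∉ Set.range c ∧ K.Adj (c n) h)
    {z : V} (hz : z ∉ Set.range c)
    (hunit : ∀ n h, h ∉ Set.range c → h ≠ z → K.Adj (c n) h → w s(c n, h) = 1) {x : V}
    (hunit_z : ∀ n, c n ≠ x → K.Adj (c n) z → w s(c n, z) = 1) :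
    m % 3 ≠ 2 := by
  intro hm2
  have ear := fun {E : Set V} {i d l : ℕ} {α : ZMod 3} =>
    ear_weight (E := E) (i := i) (d := d) (l := l) (α := α) hZ hc hadj hw hm2
  have hne : ∀ i d, 0 < d → d < m → c i ≠ c (i + d) := by
    intro i d h0 hd h
    rw [hc] at h
    have := Int.le_of_dvd (by push_cast; omega) (Nat.ModEq.dvd h)
    push_cast at this
    omega
  have hper : ∀ i d, d ≤ m → c (i + d + (m - d)) = c i := by
    intro i d hd
    rw [hc, show i + d + (m - d) = i + m by omega]
    simp [Nat.ModEq]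
  have hmem : ∀ n, c n ∈ Set.range c := fun n => ⟨n, rfl⟩
  have hcH : ∀ n h, h ∉ Set.range c → c n ≠ h := fun n h hh e => hh ⟨n, e⟩
  -- a path from the cycle into its complement
  have htail : ∀ (S : Set V) n h y, (∀ u ∈ S, u ∉ Set.range c) → K.Adj (c n) h → ConnIn K S h y →
      ∃ l τ, 1 ≤ l ∧ PathIn K w (insert (c n) S) (c n) y l τ := by
    intro S n h y hS hadj' hconn
    obtain ⟨l, τ, hp⟩ := hconn.exists_pathIn (w := w)
    exact ⟨_, _, by omega, hp.cons hadj' fun h => hS _ h (hmem n)⟩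
  -- no vertex off the cycle has two unit edges to it
  have hV2 : ∀ y, y ∉ Set.range c → ∀ i d, 0 < d → d < m → K.Adj (c i) y → K.Adj (c (i + d)) y →
      w s(c i, y) = 1 → w s(c (i + d), y) = 1 → False := by
    intro y hy
    have two : ∀ i d, 0 < d → d < m → K.Adj (c i) y → K.Adj (c (i + d)) y →
        w s(c i, y) = 1 → w s(c (i + d), y) = 1 → d % 3 ≠ 1 := by
      intro i d h0 hd h1 h2 w1 w2 h
      have hp := (PathIn.of_adj h1 (w := w)).trans (PathIn.of_adj h2.symm (w := w)) (by
        rintro t (rfl | rfl) (h | h)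
        · exact h
        · exact absurd h (hne i d h0 hd)
        · rfl
        · rfl)
      rw [Sym2.eq_swap (a := y), w1, w2] at hp
      exact (ear h0 hd hp (by
        rintro n ((h | h) | h | h)
        · exact Or.inl h
        · exact absurd h (hcH n y hy)
        · exact absurd h (hcH n y hy)
        · exact Or.inr h) le_rfl).1 h (by decide)
    have zero : ∀ i d, 0 < d → d < m → K.Adj (c i) y → K.Adj (c (i + d)) y →
        w s(c i, y) = 1 → w s(c (i + d), y) = 1 → d % 3 = 0 → False := by
      intro i d h0 hd h1 h2 w1 w2 h
      obtain ⟨h, hh, hadj'⟩ := hdom (i + 1)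
      obtain ⟨l, τ, hl, hp⟩ := htail _ (i + 1) h y (fun u hu => hu) hadj' (hH h y hh hy)
      have hi1 := hne (i + 1) (d - 1) (by omega) (by omega)
      have e1 : i + 1 + (d - 1) = i + d := by omega
      rw [e1] at hi1
      have hi0 := hne i 1 (by omega) (by omega)
      have p1 := hp.trans (PathIn.of_adj h2.symm (w := w)) (by
        intro t ht ht'
        rcases ht' with rfl | rfl
        · rfl
        · rcases ht with ht | ht
          · exact absurd ht.symm hi1
          · exact absurd (hmem _) ht)
      have p2 := hp.trans (PathIn.of_adj h1.symm (w := w)) (by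
        intro t ht ht'
        rcases ht' with rfl | rfl
        · rfl
        · rcases ht with ht | ht
          · exact absurd ht hi0
          · exact absurd (hmem _) ht)
      rw [Sym2.eq_swap, w2, ← e1] at p1
      rw [Sym2.eq_swap, w1] at p2
      have hy' := fun n => hcH n y hy
      have r1 := (ear (by omega) (by omega) p1 (by
        rintro n ((h | h) | h | h)
        · exact Or.inl h
        · exact absurd (hmem _) h
        · exact absurd h (hy' _)
        · exact Or.inr h) (by omega)).2 (by omega)
      have r2 := (ear (by omega) (by omega) p2.symm (by
        rintro n ((h | h) | h | h)
        · exact Or.inr h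
        · exact absurd (hmem _) h
        · exact absurd h (hy' _)
        · exact Or.inl h) (by omega)).1 (by omega)
      exact r2 r1
    intro i d h0 hd h1 h2 w1 w2
    have h := two i d h0 hd h1 h2 w1 w2
    have hs := hper i d hd.le
    rcases (by omega : d % 3 = 0 ∨ d % 3 = 2) with h | h
    · exact zero i d h0 hd h1 h2 w1 w2 h
    · exact zero (i + d) (m - d) (by omega) (by omega) h2 (hs ▸ h1) w2 (hs ▸ w1) (by omega)
  -- the complement is not reduced to `z`
  obtain ⟨z', hz', hzz⟩ : ∃ z', z' ∉ Set.range c ∧ z' ≠ z := by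
    by_contra! hcon
    have hadjz : ∀ n, K.Adj (c n) z := by
      intro n
      obtain ⟨h, hh, hadj'⟩ := hdom n
      rwa [hcon h hh] at hadj'
    obtain ⟨i, h0, h1⟩ : ∃ i, c i ≠ x ∧ c (i + 1) ≠ x := by
      by_contra! hcon'
      have h01 := hne 0 1 (by omega) (by omega)
      have h02 := hne 0 2 (by omega) (by omega)
      have h12 := hne 1 1 (by omega) (by omega)
      by_cases h0 : c 0 = x
      · exact h02 (h0.trans (hcon' 1 fun h => h01 (h0.trans h.symm)).symm)
      · have h1 := hcon' 0 h0
        rw [zero_add] at h1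
        exact hne 1 2 (by omega) (by omega) (h1.trans (hcon' 2 fun h => h12 (h1.trans h.symm)).symm)
    exact hV2 z hz i 1 (by omega) (by omega) (hadjz _) (hadjz _) (hunit_z _ h0 (hadjz _))
      (hunit_z _ h1 (hadjz _))
  obtain ⟨Y, t, hYne, hYH, hzY, htH, htY, hN, hL⟩ :=
    exists_end (K := K) (H := {t | t ∉ Set.range c}) hz hz' hzz
  replace hYH : ∀ y ∈ Y, y ∉ Set.range c := hYH
  have hLH : ∀ y ∈ insert t Y, y ∉ Set.range c := by
    rintro y (rfl | hy)
    exacts [htH, hYH y hy]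
  have hunitY : ∀ n, ∀ y ∈ Y, K.Adj (c n) y → w s(c n, y) = 1 := fun n y hy h =>
    hunit n y (hYH y hy) (fun h => hzY (h ▸ hy)) h
  have hatt : ∀ i₀, ∃ j, c j ≠ c i₀ ∧ ∃ y ∈ Y, K.Adj (c j) y := by
    intro i₀
    by_contra! hcon
    have := hK Y hYne t (c i₀) (fun y hy u hyu => by
      by_cases hu : u ∈ Set.range c
      · obtain ⟨n, rfl⟩ := hu
        right; right
        by_contra hne
        exact hcon n hne y hy hyu.symm
      · rcases hN y hy u hu hyu with h | h
        exacts [Or.inl h, Or.inr (Or.inl h)]) (c (i₀ + 1))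
    rcases this with h | h | h
    · exact hYH _ h (hmem _)
    · exact htH (h ▸ hmem _)
    · exact hne i₀ 1 (by omega) (by omega) h.symm
  have hpair : ∀ i d, 0 < d → d < m → (∃ y ∈ Y, K.Adj (c i) y) → (∃ y ∈ Y, K.Adj (c (i + d)) y) →
      d % 3 = 1 := by
    rintro i d h0 hd ⟨y, hy, hiy⟩ ⟨y', hy', hiy'⟩
    by_contra hd1
    have hyy : y ≠ y' := by
      rintro rfl
      exact hV2 y (hYH y hy) i d h0 hd hiy hiy' (hunitY _ _ hy hiy) (hunitY _ _ hy hiy')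
    have zero : ∀ (S : Set V) l α, (∀ x ∈ S, x ∈ insert t Y) → PathIn K w S y y' l α → α = 0 := by
      intro S l α hS hp
      have p1 := hp.cons hiy (fun h => hLH _ (hS _ h) (hmem _))
      have p2 := p1.trans (PathIn.of_adj hiy'.symm (w := w)) (by
        intro u hu hu'
        rcases hu' with rfl | rfl
        · rfl
        · rcases hu with h | h
          · exact absurd h.symm (hne i d h0 hd)
          · exact absurd (hmem _) (hLH _ (hS _ h)))
      rw [hunitY _ _ hy hiy, Sym2.eq_swap, hunitY _ _ hy' hiy'] at p2
      have := (ear h0 hd p2 (by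
        rintro n ((h | h) | h | h)
        · exact Or.inl h
        · exact absurd (hmem _) (hLH _ (hS _ h))
        · exact absurd h (hcH _ _ (hYH _ hy'))
        · exact Or.inr h) (by omega)).2 hd1
      clear p1 p2 hp
      revert α; decide
    obtain ⟨S, T, l, k, α, β, hS, hT, hST, hl, hSL, hTL⟩ := twoPaths_of_connected (w := w) hL (by
      intro a b
      by_contra! hcon
      have h1 := hcon t (Or.inl rfl)
      have h2 := hcon y (Or.inr hy)
      have h3 := hcon y' (Or.inr hy')
      have h4 : t ≠ y := fun h => htY (h ▸ hy)
      have h5 : t ≠ y' := fun h => htY (h ▸ hy')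
      by_cases e1 : t = a
      · exact hyy ((h2 fun e => h4 (e1.trans e.symm)).trans (h3 fun e => h5 (e1.trans e.symm)).symm)
      · have e2 := h1 e1
        by_cases e3 : y = a
        · exact h5 (e2.trans (h3 fun e => hyy (e3.trans e.symm)).symm)
        · exact h4 (e2.trans (h2 e3).symm)) (Set.mem_insert_of_mem t hy)
        (Set.mem_insert_of_mem t hy') hyy
    refine hZ ⟨y, y', S, T, l, k, α, β, hyy, hS, hT, hST, hl, ?_⟩
    rw [zero S l α hSL hS, zero T k β hTL hT, add_zero]
  -- two attachments, far apart
  obtain ⟨i, d, hd4, hd, hd1, ⟨y, hy, hiy⟩, y', hy', hiy'⟩ : ∃ i d, 4 ≤ d ∧ d < m ∧ d % 3 = 1 ∧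
      (∃ y ∈ Y, K.Adj (c i) y) ∧ ∃ y ∈ Y, K.Adj (c (i + d)) y := by
    obtain ⟨i, -, hi⟩ := hatt 0
    obtain ⟨j, hij, hj⟩ := hatt i
    obtain ⟨d, h0, hd, hjd⟩ := exists_shift hc (by omega) hij.symm
    rw [hjd] at hj
    have hd1 := hpair i d h0 hd hi hj
    by_cases h4 : 4 ≤ d
    · exact ⟨i, d, h4, hd, hd1, hi, hj⟩
    · exact ⟨i + d, m - d, by omega, by omega, by omega, hj, by rwa [hper i d hd.le]⟩
  -- paths from the cycle to `t` avoiding `Y`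
  have htail' : ∀ n, (¬ ∃ y ∈ Y, K.Adj (c n) y) → ∃ l τ, 1 ≤ l ∧
      PathIn K w (insert (c n) {u | u ∉ Set.range c ∧ u ∉ Y}) (c n) t l τ := by
    intro n hn
    obtain ⟨h, hh, hadj'⟩ := hdom n
    have hhY : h ∉ Y := fun hY => hn ⟨h, hY, hadj'⟩
    refine htail _ n h t (fun u hu => hu.1) hadj' ?_
    have := (hH h t hh htH).induct
      (P := fun b => ConnIn K {u | u ∉ Set.range c ∧ u ∉ Y} h t ∨
        ConnIn K {u | u ∉ Set.range c ∧ u ∉ Y} h b) (Or.inr (.refl ⟨hh, hhY⟩)) ?_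
    · exact this.elim id id
    · rintro a b (hP | hP) ha hb hab
      · exact Or.inl hP
      · by_cases hbY : b ∈ Y
        · rcases hN b hbY a ha hab.symm with h | h
          · exact absurd h hP.right_mem.2
          · exact Or.inl (h ▸ hP)
        · exact Or.inr (hP.step hab ⟨hb, hbY⟩)
  have hfull : ∀ n j y l τ l' β, c n ≠ c j → y ∈ Y → K.Adj (c j) y → 1 ≤ l →
      PathIn K w (insert (c n) {u | u ∉ Set.range c ∧ u ∉ Y}) (c n) t l τ →
      PathIn K w (insert t Y) t y l' β →
      ∃ E l, 2 ≤ l ∧ PathIn K w E (c n) (c j) l (τ + β + 1) ∧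
        ∀ k, c k ∈ E → c k = c n ∨ c k = c j := by
    intro n j y l τ l' β hnj hy hjy hl hp hq
    have p1 := hp.trans hq (by
      rintro u (hu | hu) hu'
      · exact absurd (hu ▸ hmem _) (hLH _ hu')
      · rcases hu' with h | h
        exacts [h, absurd h hu.2])
    have p2 := p1.trans (PathIn.of_adj hjy.symm (w := w)) (by
      intro u hu hu'
      rcases hu' with rfl | rfl
      · rfl
      · rcases hu with (h | h) | h
        · exact absurd h.symm hnj
        · exact absurd (hmem _) h.1
        · exact absurd (hmem _) (hLH _ h))
    rw [Sym2.eq_swap, hunitY _ _ hy hjy] at p2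
    refine ⟨_, _, by omega, p2, ?_⟩
    rintro k (((h | h) | h) | h | h)
    · exact Or.inl h
    · exact absurd (hmem _) h.1
    · exact absurd (hmem _) (hLH _ h)
    · exact absurd h (hcH _ _ (hYH _ hy))
    · exact Or.inr h
  have hyy : y ≠ y' := by
    rintro rfl
    exact hV2 y (hYH y hy) i d (by omega) hd hiy hiy' (hunitY _ _ hy hiy) (hunitY _ _ hy hiy')
  have hLt : ∀ y ∈ Y, ∀ y' ∈ Y, y ≠ y' → ∃ l β, PathIn K w (insert t Y) t y l β := by
    intro y hy y' hy' hyy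
    exact ((hL y' (Or.inr hy') t (Or.inl rfl) y (Or.inr hy) (fun h => htY (h ▸ hy')) hyy).mono
      fun u hu => hu.1).exists_pathIn
  obtain ⟨la, α, hα⟩ := hLt y hy y' hy' hyy
  obtain ⟨lb, β, hβ⟩ := hLt y' hy' y hy hyy.symm
  have hn1 : ¬ ∃ y ∈ Y, K.Adj (c (i + 1)) y := by
    intro h
    have := hpair (i + 1) (d - 1) (by omega) (by omega) h
      (by rw [show i + 1 + (d - 1) = i + d by omega]; exact ⟨y', hy', hiy'⟩)
    omega
  have hn2 : ¬ ∃ y ∈ Y, K.Adj (c (i + 2)) y := by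
    intro h
    have := hpair i 2 (by omega) (by omega) ⟨y, hy, hiy⟩ h
    omega
  obtain ⟨l₁, τ₁, hl₁, hτ₁⟩ := htail' _ hn1
  obtain ⟨l₂, τ₂, hl₂, hτ₂⟩ := htail' _ hn2
  have e1 : i + 1 + (d - 1) = i + d := by omega
  have e2 : i + 2 + (d - 2) = i + d := by omega
  have r1 : τ₁ + β + 1 = 2 := by
    obtain ⟨E, l, hl, hp, hE⟩ := hfull (i + 1) (i + d) y' _ _ _ _
      (e1 ▸ hne (i + 1) (d - 1) (by omega) (by omega)) hy' hiy' hl₁ hτ₁ hβ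
    exact (ear (i := i + 1) (d := d - 1) (by omega) (by omega) (e1.symm ▸ hp) (e1.symm ▸ hE)
      hl).2 (by omega)
  have r2 : τ₂ + β + 1 = 2 := by
    obtain ⟨E, l, hl, hp, hE⟩ := hfull (i + 2) (i + d) y' _ _ _ _
      (e2 ▸ hne (i + 2) (d - 2) (by omega) (by omega)) hy' hiy' hl₂ hτ₂ hβ
    exact (ear (i := i + 2) (d := d - 2) (by omega) (by omega) (e2.symm ▸ hp) (e2.symm ▸ hE)
      hl).2 (by omega)
  have r3 : τ₁ + α + 1 ≠ 2 := by
    obtain ⟨E, l, hl, hp, hE⟩ := hfull (i + 1) i y _ _ _ _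
      (hne i 1 (by omega) (by omega)).symm hy hiy hl₁ hτ₁ hα
    exact (ear (i := i) (d := 1) (by omega) (by omega) hp.symm (fun k hk => (hE k hk).symm)
      hl).1 (by omega)
  have r4 : τ₂ + α + 1 = 2 := by
    obtain ⟨E, l, hl, hp, hE⟩ := hfull (i + 2) i y _ _ _ _
      (hne i 2 (by omega) (by omega)).symm hy hiy hl₂ hτ₂ hα
    exact (ear (i := i) (d := 2) (by omega) (by omega) hp.symm (fun k hk => (hE k hk).symm)
      hl).2 (by omega)
  have : τ₁ = τ₂ := by
    have := r1.trans r2.symm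
    simpa using this
  exact r3 (this ▸ r4)

end NonseparatingCycle

section Core

variable {V : Type*} {K : SimpleGraph V} {w : Sym2 V → ZMod 3}

/-- The cyclic parametrisation of the cycle formed by a path and an edge joining its ends. -/
lemma exists_cycle_fun {a b : V} (hab : K.Adj a b) (P : (K.deleteEdges {s(a, b)}).Walk a b)
    (hP : P.IsPath) : ∃ c : ℕ → V, (∀ i j, c i = c j ↔ i ≡ j [MOD (P.length + 1)]) ∧
      (∀ n, K.Adj (c n) (c (n + 1))) ∧ Set.range c = {t | t ∈ P.support} ∧ c 0 = a := by
  have hlt : ∀ n, n % (P.length + 1) ≤ P.length := fun n =>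
    Nat.le_of_lt_succ (Nat.mod_lt _ (Nat.succ_pos _))
  refine ⟨fun n => P.getVert (n % (P.length + 1)), fun i j => ⟨fun h => ?_, fun h => ?_⟩,
    fun n => ?_, ?_, by simp⟩
  · exact hP.getVert_injOn (hlt i) (hlt j) h
  · exact congrArg P.getVert h
  · by_cases h : n % (P.length + 1) < P.length
    · have h1 : (n + 1) % (P.length + 1) = n % (P.length + 1) + 1 := by
        rw [Nat.add_mod, Nat.mod_eq_of_lt (a := 1) (by omega), Nat.mod_eq_of_lt (by omega)]
      simp only [h1]
      exact (K.deleteEdges_adj.1 (P.adj_getVert_succ h)).1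
    · have h0 : n % (P.length + 1) = P.length := le_antisymm (hlt n) (not_lt.1 h)
      have h1 : (n + 1) % (P.length + 1) = 0 := by
        rw [← Nat.mod_add_mod, h0, Nat.mod_self]
      simp only [h0, h1, P.getVert_length, P.getVert_zero]
      exact hab.symm
  · ext t
    simp only [Set.mem_range, Set.mem_ofPred_eq]
    constructor
    · rintro ⟨n, rfl⟩
      exact P.getVert_mem_support _
    · intro ht
      obtain ⟨n, rfl, hn⟩ := Walk.mem_support_iff_exists_getVert.1 ht
      exact ⟨n, by rw [Nat.mod_eq_of_lt (by omega)]⟩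

lemma two_le_length {a b : V} (hab : K.Adj a b) (P : (K.deleteEdges {s(a, b)}).Walk a b) :
    2 ≤ P.length := by
  by_contra! h
  have h0 : P.length ≠ 0 := fun h => hab.ne (Walk.eq_of_length_eq_zero h)
  have := Walk.adj_of_length_eq_one (p := P) (by omega)
  simp at this

lemma pathIn_of_walk {a b : V} {s : Set (Sym2 V)} (P : (K.deleteEdges s).Walk a b) (hP : P.IsPath)
    (hw : ∀ p q, p ∈ P.support → q ∈ P.support → w s(p, q) = 1) :
    PathIn K w {t | t ∈ P.support} a b P.length P.length := by
  refine ⟨P.mapLe (K.deleteEdges_le _), hP.mapLe _, by simp, by simp, ?_⟩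
  rw [wt_eq_length]
  · simp
  · intro e he
    rw [Walk.edges_mapLe_eq_edges] at he
    induction e using Sym2.ind with
    | _ p q => exact hw p q (P.fst_mem_support_of_mem_edges he) (P.snd_mem_support_of_mem_edges he)

/-- A nonseparating path with unit weights around it, whose ends are adjacent, has length divisible
by three. -/
lemma nonseparating_path_length [Finite V] (hK : NoTwoCut K) (hZ : ¬ HasZeroCycle K w) {a b : V}
    (hab : K.Adj a b) (P : (K.deleteEdges {s(a, b)}).Walk a b) (hP : P.IsPath)
    (hconn : ∀ y z, y ∉ P.support → z ∉ P.support → ConnIn K {t | t ∉ P.support} y z)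
    (hdom : ∀ d ∈ P.support, ∃ h, h ∉ P.support ∧ K.Adj d h) {x z : V} (hz : z ∉ P.support)
    (hwP : ∀ p q, p ∈ P.support → q ∈ P.support → w s(p, q) = 1)
    (hunit : ∀ p h, p ∈ P.support → h ≠ z → w s(p, h) = 1)
    (hunit_z : ∀ p, p ∈ P.support → p ≠ x → w s(p, z) = 1) : P.length % 3 = 0 := by
  have h2 := two_le_length hab P
  obtain ⟨c, hc, hadj, hrange, -⟩ := exists_cycle_fun hab P hP
  have hmem : ∀ n, c n ∈ P.support := fun n => by
    have : c n ∈ Set.range c := ⟨n, rfl⟩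
    rwa [hrange] at this
  have hmem' : ∀ t, t ∈ Set.range c ↔ t ∈ P.support := fun t => by rw [hrange]; rfl
  have h := nonseparating_cycle_length hK hZ (c := c) (m := P.length + 1) (by omega) hc hadj
    (fun n => hwP _ _ (hmem _) (hmem _)) (by simpa only [hmem'] using hconn)
    (fun n => by simpa only [hmem'] using hdom _ (hmem n)) (z := z) (by rwa [hmem'])
    (fun n h _ hz _ => hunit _ _ (hmem n) hz) (x := x) (fun n hx _ => hunit_z _ (hmem n) hx)
  have h' : ((P.length + 1 : ℕ) : ZMod 3) ≠ 0 := by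
    intro h
    refine hZ ⟨a, b, _, _, _, _, _, _, hab.ne, pathIn_of_walk P hP hwP, .of_adj hab, ?_, h2, ?_⟩
    · rintro x - (rfl | rfl)
      exacts [Or.inl rfl, Or.inr rfl]
    · rw [hwP _ _ P.start_mem_support P.end_mem_support]
      exact_mod_cast h
  rw [Ne, ZMod.natCast_eq_zero_iff] at h'
  omega

lemma NoTwoCut.exists_adj [Finite V] (hK : NoTwoCut K) (hcard : 4 ≤ Nat.card V) (v l r : V) :
    ∃ y, K.Adj v y ∧ y ≠ l ∧ y ≠ r := by
  by_contra! hcon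
  have := hK {v} ⟨v, rfl⟩ l r (fun q hq y hqy => by
    rw [Set.mem_singleton_iff] at hq
    subst hq
    by_cases h : y = l
    · exact Or.inr (Or.inl h)
    · exact Or.inr (Or.inr (hcon y hqy h)))
  have h3 : (Set.univ : Set V) ⊆ {v, l, r} := fun x _ => this x
  have h4 := Set.ncard_le_ncard h3 (Set.toFinite _)
  rw [Set.ncard_univ] at h4
  have h5 := Set.ncard_insert_le v {l, r}
  have h6 := Set.ncard_insert_le l {r}
  rw [Set.ncard_singleton] at h6
  omega

/-- A graph without 2-vertex-cuts, all of whose edges except possibly one have weight one, has a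
zero cycle. -/
theorem hasZeroCycle_of_noTwoCut [Finite V] (hK : NoTwoCut K) (hcard : 4 ≤ Nat.card V) {u v : V}
    (huv : K.Adj u v) (hw : ∀ e, e ≠ s(u, v) → w e = 1) : HasZeroCycle K w := by
  by_contra hZ
  have hw' : ∀ p q, (p ≠ u ∧ q ≠ u) ∨ (p ≠ v ∧ q ≠ v) → w s(p, q) = 1 := by
    intro p q h
    refine hw _ fun e => ?_
    rw [Sym2.eq_iff] at e
    tauto
  obtain ⟨v', hvv', hv'u, -⟩ := hK.exists_adj hcard v u u
  have hconn : ConnIn (K.deleteEdges {s(v, v')}) {t | t ∈ ({u} : Set V)}ᶜ v v' := by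
    by_contra hcon
    replace hcon : ¬ ConnIn (K.deleteEdges {s(v, v')}) {u}ᶜ v' v := fun h => hcon h.symm
    have hv' : ConnIn (K.deleteEdges {s(v, v')}) {u}ᶜ v' v' := .refl hv'u
    have hall := hK {y | ConnIn (K.deleteEdges {s(v, v')}) {u}ᶜ v' y} ⟨v', hv'⟩ u v
      (fun q hq y hqy => by
        by_cases hyu : y = u
        · exact Or.inr (Or.inl hyu)
        by_cases hyv : y = v
        · exact Or.inr (Or.inr hyv)
        refine Or.inl (ConnIn.step hq (K.deleteEdges_adj.2 ⟨hqy, ?_⟩) hyu)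
        rw [Set.mem_singleton_iff, Sym2.eq_iff]
        rintro (⟨rfl, rfl⟩ | ⟨rfl, rfl⟩)
        · exact hcon hq
        · exact hyv rfl)
    obtain ⟨y, hvy, hyu, hyv'⟩ := hK.exists_adj hcard v u v'
    rcases hall y with h | h | h
    · refine hcon (ConnIn.step h (K.deleteEdges_adj.2 ⟨hvy.symm, ?_⟩) huv.ne.symm)
      rw [Set.mem_singleton_iff, Sym2.eq_iff]
      rintro (⟨rfl, rfl⟩ | ⟨rfl, -⟩)
      · exact hvy.ne rfl
      · exact hyv' rfl
    · exact hyu h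
    · exact hvy.ne h.symm
  obtain ⟨P, hP, hPX, hPconn, hPdom⟩ := exists_nonseparating_path hK {u} (x₀ := u) rfl
    (by rintro x rfl; exact .refl rfl) hconn
  have huP : ∀ x ∈ P.support, x ≠ u := fun x hx => hPX x hx
  have hlen := nonseparating_path_length hK hZ hvv' P hP hPconn hPdom (x := v) (z := u)
    (fun h => huP u h rfl) (fun p q hp hq => hw' p q (Or.inl ⟨huP p hp, huP q hq⟩))
    (fun p h hp hh => hw' p h (Or.inl ⟨huP p hp, hh⟩))
    (fun p hp hpv => hw' p u (Or.inr ⟨hpv, huv.ne⟩))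
  have h2 := two_le_length hvv' P
  obtain ⟨c, hc, hadj, hrange, hc0⟩ := exists_cycle_fun hvv' P hP
  have hmem : ∀ n, c n ∈ P.support := fun n => by
    have : c n ∈ Set.range c := ⟨n, rfl⟩
    rwa [hrange] at this
  have hcw : ∀ n, w s(c n, c (n + 1)) = 1 := fun n =>
    hw' _ _ (Or.inl ⟨huP _ (hmem _), huP _ (hmem _)⟩)
  set m := P.length + 1 with hm
  have hne : ∀ i j, i < j → j < i + m → c i ≠ c j := by
    intro i j h0 hd h
    rw [hc] at h
    have := Int.le_of_dvd (by omega) (Nat.ModEq.dvd h)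
    omega
  have hcm : ∀ i, c (i + m) = c i := fun i => by rw [hc]; simp [Nat.ModEq]
  -- the rest of the cycle, with the edge `c 1, c 2` removed
  have hX : ∀ x ∈ {t | t ∈ P.support ∧ t ≠ c 1 ∧ t ≠ c 2}, ∃ n, 3 ≤ n ∧ n ≤ m ∧ c n = x := by
    rintro x ⟨hx, hx1, hx2⟩
    have hx' : x ∈ Set.range c := by rw [hrange]; exact hx
    obtain ⟨n, rfl⟩ := hx'
    have hn : c n = c (n % m) := by rw [hc]; exact (Nat.mod_modEq n m).symm
    have hlt : n % m < m := Nat.mod_lt _ (by omega)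
    rw [hn] at hx1 hx2 ⊢
    by_cases h0 : n % m = 0
    · exact ⟨m, by omega, le_rfl, by rw [h0]; simpa using hcm 0⟩
    · have h1 : n % m ≠ 1 := fun h => hx1 (by rw [h])
      have h2 : n % m ≠ 2 := fun h => hx2 (by rw [h])
      exact ⟨n % m, by omega, hlt.le, rfl⟩
  have hX' : ∀ n, 3 ≤ n → n ≤ m → c n ∈ {t | t ∈ P.support ∧ t ≠ c 1 ∧ t ≠ c 2} := fun n h3 hn =>
    ⟨hmem n, (hne 1 n (by omega) (by omega)).symm, (hne 2 n (by omega) (by omega)).symm⟩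
  have hcm0 : c m = v := by rw [← hc0, ← hcm 0, zero_add]
  have hvX : v ∈ {t | t ∈ P.support ∧ t ≠ c 1 ∧ t ≠ c 2} := by
    have h := hX' m (by omega) le_rfl
    rwa [hcm0] at h
  have hXconn : ∀ x ∈ {t | t ∈ P.support ∧ t ≠ c 1 ∧ t ≠ c 2},
      ConnIn K {t | t ∈ P.support ∧ t ≠ c 1 ∧ t ≠ c 2} v x := by
    intro x hx
    obtain ⟨n, h3, hn, rfl⟩ := hX x hx
    have := (pathIn_arc hc hadj hcw n (m - n) (by omega)).connIn
    rw [show n + (m - n) = m by omega, hcm0] at this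
    refine (this.mono ?_).symm
    rintro t ⟨k, hk, hk', rfl⟩
    exact hX' k (by omega) hk'
  have h12 : ConnIn (K.deleteEdges {s(c 1, c 2)}) {t | t ∈ P.support ∧ t ≠ c 1 ∧ t ≠ c 2}ᶜ
      (c 1) (c 2) := by
    obtain ⟨y₁, hy₁, ha₁⟩ := hPdom _ (hmem 1)
    obtain ⟨y₂, hy₂, ha₂⟩ := hPdom _ (hmem 2)
    have hoff : ∀ {x y}, x ∉ P.support → K.Adj x y → (K.deleteEdges {s(c 1, c 2)}).Adj x y := by
      intro x y hx hxy
      refine K.deleteEdges_adj.2 ⟨hxy, ?_⟩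
      rw [Set.mem_singleton_iff, Sym2.eq_iff]
      rintro (⟨rfl, -⟩ | ⟨rfl, -⟩)
      exacts [hx (hmem _), hx (hmem _)]
    have hY := (hPconn y₁ y₂ hy₁ hy₂).of_transfer (G' := K.deleteEdges {s(c 1, c 2)})
      (T := {t | t ∈ P.support ∧ t ≠ c 1 ∧ t ≠ c 2}ᶜ) (fun t ht ht' => ht ht'.1)
      (fun x y hx _ => hoff hx)
    refine ConnIn.trans ?_ (hY.step (hoff hy₂ ha₂.symm) fun h => h.2.2 rfl)
    exact .of_adj (hoff hy₁ ha₁.symm).symm (fun h => h.2.1 rfl) hY.left_mem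
  obtain ⟨P₂, hP₂, hP₂X, hP₂conn, hP₂dom⟩ := exists_nonseparating_path hK _
    hvX hXconn h12
  have hvP₂ : ∀ x ∈ P₂.support, x ≠ v := fun x hx h =>
    hP₂X v (h ▸ hx) hvX
  have hwP₂ : ∀ p q, p ∈ P₂.support → q ∈ P₂.support → w s(p, q) = 1 :=
    fun p q hp hq => hw' p q (Or.inr ⟨hvP₂ p hp, hvP₂ q hq⟩)
  have hlen₂ := nonseparating_path_length hK hZ (hadj 1) P₂ hP₂ hP₂conn hP₂dom (x := u) (z := v)
    (fun h => hvP₂ v h rfl) hwP₂ (fun p h hp hh => hw' p h (Or.inr ⟨hvP₂ p hp, hh⟩))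
    (fun p hp hpu => hw' p v (Or.inl ⟨hpu, huv.ne.symm⟩))
  have harc := pathIn_arc hc hadj hcw 2 (m - 1) (by omega)
  rw [show 2 + (m - 1) = 1 + m by omega, hcm] at harc
  refine hZ ⟨_, _, _, _, _, _, _, _, (hadj 1).ne, harc.symm, pathIn_of_walk P₂ hP₂ hwP₂, ?_,
    by omega, ?_⟩
  · rintro x ⟨n, -, -, rfl⟩ hx
    by_contra! hcon
    exact hP₂X _ hx ⟨hmem n, hcon⟩
  · have h3 : (m - 1) + P₂.length = 3 * ((m - 1 + P₂.length) / 3) := by omega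
    rw [← Nat.cast_add, h3, ZMod.natCast_eq_zero_iff]
    exact dvd_mul_right _ _

end Core

section Lift

variable {V : Type*} {G : SimpleGraph V} {U : Set V} {K : SimpleGraph U} {w : Sym2 U → ZMod 3}

/-- A path in `K` lifts to a path in `G` once the special edge is replaced by a path. -/
lemma exists_lift {u v : U} (hK : ∀ x y, K.Adj x y → s(x, y) = s(u, v) ∨ G.Adj x y)
    (hw : ∀ e, e ≠ s(u, v) → w e = 1) {L : G.Walk u v} (hL : L.IsPath)
    (hLU : ∀ x : U, (x : V) ∈ L.support → x = u ∨ x = v) (huv : u ≠ v)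
    (hwL : w s(u, v) = L.length) {x y : U} (p : K.Walk x y) (hp : p.IsPath) :
    ∃ l, p.length ≤ l ∧ PathIn G (fun _ => 1)
      {z | (∃ h : z ∈ U, ⟨z, h⟩ ∈ p.support) ∨ (s(u, v) ∈ p.edges ∧ z ∈ L.support ∧ z ∉ U)}
      x y l (wt w p) := by
  induction p with
  | nil => exact ⟨0, le_rfl, Walk.nil, .nil, by simp, rfl, rfl⟩
  | @cons x y z h p ih =>
    rw [Walk.cons_isPath_iff] at hp
    obtain ⟨l, hl, hpl⟩ := ih hp.1
    have hfirst : ∃ m, 1 ≤ m ∧ PathIn G (fun _ => 1)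
        {z | z = x.1 ∨ z = y.1 ∨ (s(u, v) = s(x, y) ∧ z ∈ L.support ∧ z ∉ U)}
        x y m (w s(x, y)) := by
      by_cases hxy : s(x, y) = s(u, v)
      · have hL1 : 1 ≤ L.length := by
          by_contra! h0
          exact huv (Subtype.ext (Walk.eq_of_length_eq_zero (p := L) (by omega)))
        have hLs : ∀ z ∈ L.support, z = u.1 ∨ z = v.1 ∨ (z ∈ L.support ∧ z ∉ U) := by
          intro z hz
          by_cases hzU : z ∈ U
          · exact (hLU ⟨z, hzU⟩ hz).imp (congrArg Subtype.val)
              fun h => Or.inl (congrArg Subtype.val h)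
          · exact Or.inr (Or.inr ⟨hz, hzU⟩)
        have hLp : PathIn G (fun _ => 1)
            {z | z = u.1 ∨ z = v.1 ∨ (z ∈ L.support ∧ z ∉ U)} u v L.length (w s(u, v)) :=
          ⟨L, hL, hLs, rfl, by rw [hwL]; exact wt_eq_length L fun _ _ => rfl⟩
        refine ⟨_, hL1, ?_⟩
        rw [hxy]
        rcases Sym2.eq_iff.1 hxy with ⟨rfl, rfl⟩ | ⟨rfl, rfl⟩
        · exact hLp.mono fun z hz => hz.imp id (Or.imp id fun h => ⟨rfl, h⟩)
        · refine hLp.symm.mono fun z hz => ?_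
          rcases hz with h | h | h
          exacts [Or.inr (Or.inl h), Or.inl h, Or.inr (Or.inr ⟨rfl, h⟩)]
      · refine ⟨1, le_rfl, ?_⟩
        have := PathIn.of_adj (w := fun _ => 1) ((hK x y h).resolve_left hxy)
        rw [hw _ hxy]
        refine this.mono fun z hz => ?_
        rcases hz with h | h
        exacts [Or.inl h, Or.inr (Or.inl h)]
    obtain ⟨m, hm, hxm⟩ := hfirst
    refine ⟨m + l, by rw [Walk.length_cons]; omega, ?_⟩
    rw [wt_cons]
    refine (hxm.trans hpl ?_).mono ?_
    · rintro t (rfl | rfl | ⟨he, -, ht⟩) (⟨h1, h2⟩ | ⟨h1, -, h2⟩)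
      · exact absurd h2 hp.2
      · exact absurd x.2 h2
      · rfl
      · rfl
      · exact absurd h1 ht
      · rw [he] at h1
        exact absurd (p.fst_mem_support_of_mem_edges h1) hp.2
    · rintro t ((rfl | rfl | ⟨he, ht, ht'⟩) | ⟨h1, h2⟩ | ⟨h1, h2⟩)
      · exact Or.inl ⟨x.2, by simp⟩
      · exact Or.inl ⟨y.2, by simp⟩
      · exact Or.inr ⟨by simp [he], ht, ht'⟩
      · exact Or.inl ⟨h1, by simp [h2]⟩
      · exact Or.inr ⟨by simp [h1], h2⟩

lemma HasZeroCycle.lift {u v : U} (hZ : HasZeroCycle K w)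
    (hK : ∀ x y, K.Adj x y → s(x, y) = s(u, v) ∨ G.Adj x y)
    (hw : ∀ e, e ≠ s(u, v) → w e = 1) {L : G.Walk u v} (hL : L.IsPath)
    (hLU : ∀ x : U, (x : V) ∈ L.support → x = u ∨ x = v) (huv : u ≠ v)
    (hwL : w s(u, v) = L.length) : HasZeroCycle G (fun _ => 1) := by
  obtain ⟨a, b, S, T, -, -, -, -, hab, ⟨p, hp, hpS, rfl, rfl⟩, ⟨q, hq, hqT, rfl, rfl⟩, hST, h2,
    h0⟩ := hZ
  obtain ⟨l, hl, hpl⟩ := exists_lift hK hw hL hLU huv hwL p hp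
  obtain ⟨m, -, hqm⟩ := exists_lift hK hw hL hLU huv hwL q hq
  refine ⟨a, b, _, _, l, m, _, _, fun h => hab (Subtype.ext h), hpl, hqm, ?_, h2.trans hl, h0⟩
  rintro x (⟨h1, h2⟩ | ⟨h1, -, h2⟩) (⟨h3, h4⟩ | ⟨h3, -, h4⟩)
  · exact (hST _ (hpS _ h2) (hqT _ h4)).imp (congrArg Subtype.val) (congrArg Subtype.val)
  · exact absurd h1 h4
  · exact absurd h3 h2
  · have hu := hST u (hpS _ (p.fst_mem_support_of_mem_edges h1))
      (hqT _ (q.fst_mem_support_of_mem_edges h3))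
    have hv := hST v (hpS _ (p.snd_mem_support_of_mem_edges h1))
      (hqT _ (q.snd_mem_support_of_mem_edges h3))
    have he : s(u, v) = s(a, b) := by
      rw [Sym2.eq_iff]
      rcases hu with rfl | rfl <;> rcases hv with rfl | rfl <;> tauto
    rw [he] at h1
    have := hp.length_eq_one_of_mem_edges h1
    omega

lemma HasZeroCycle.exists_isCycle (hZ : HasZeroCycle G fun _ => 1) :
    ∃ (a : V) (c : G.Walk a a), c.IsCycle ∧ 3 ∣ c.length := by
  obtain ⟨a, b, S, T, -, -, -, -, hab, ⟨p, hp, hpS, rfl, rfl⟩, ⟨q, hq, hqT, rfl, rfl⟩, hST, h2,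
    h0⟩ := hZ
  refine ⟨a, p.append q.reverse, hp.isCycle_append hq.reverse ?_ (Or.inl h2), ?_⟩
  · intro x hx hx'
    rcases hST x (hpS x (List.mem_of_mem_tail hx))
      (hqT x (by simpa using List.mem_of_mem_tail hx')) with rfl | rfl
    · have h3 := hp.support_nodup
      rw [← Walk.cons_tail_support] at h3
      exact (List.nodup_cons.1 h3).1 hx
    · have h3 := hq.reverse.support_nodup
      rw [← Walk.cons_tail_support] at h3
      exact (List.nodup_cons.1 h3).1 hx'
  · rw [wt_eq_length p fun _ _ => rfl, wt_eq_length q fun _ _ => rfl, ← Nat.cast_add,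
      ZMod.natCast_eq_zero_iff] at h0
    simpa using h0

end Lift

section MinDegree

variable {V : Type*} {G : SimpleGraph V}

/-- Every neighbour of a vertex of `Q` lies in `Q` or is one of `l`, `r`. -/
def Encloses (G : SimpleGraph V) (Q : Set V) (l r : V) : Prop :=
  ∀ q ∈ Q, ∀ y, G.Adj q y → y ∈ Q ∨ y = l ∨ y = r

lemma hasZeroCycle_of_region [Finite V] {R U : Set V}
    (hclosed : ∀ x ∈ R, ∀ y, G.Adj x y → y ∈ U) (hU : 4 ≤ U.ncard) {u v : U} (huv : u ≠ v)
    {L : G.Walk u v} (hL : L.IsPath) (hLU : ∀ x : U, (x : V) ∈ L.support → x = u ∨ x = v)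
    (hclique : ∀ x y : U, (x : V) ∉ R → (y : V) ∉ R → x ≠ y → G.Adj x y ∨ s(x, y) = s(u, v))
    (hsep : ∀ M ⊆ R, M.Nonempty → ∀ l r, Encloses G M l r → ∀ x ∈ U, x ∈ M ∨ x = l ∨ x = r) :
    HasZeroCycle G fun _ => 1 := by
  classical
  let K : SimpleGraph U :=
    { Adj := fun x y => x ≠ y ∧ (G.Adj x y ∨ s(x, y) = s(u, v))
      symm := ⟨fun x y h => ⟨h.1.symm, h.2.imp (fun h' => h'.symm)
        fun h' => Sym2.eq_swap.trans h'⟩⟩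
      loopless := ⟨fun x h => h.1 rfl⟩ }
  have hKG : ∀ {x y : U}, G.Adj x y → K.Adj x y := fun h =>
    ⟨fun h' => h.ne (congrArg _ h'), Or.inl h⟩
  have hK : NoTwoCut K := by
    intro Q hQ l r hlr
    by_contra! hcon
    obtain ⟨m, hmQ, hml, hmr⟩ := hcon
    have hleave : ∀ q ∈ Q, ∀ y, y ∉ Q → y ≠ l → y ≠ r → ¬ K.Adj q y := by
      intro q hq y h1 h2 h3 h
      rcases hlr q hq y h with h | h | h
      exacts [h1 h, h2 h, h3 h]
    by_cases hQR : ∀ q ∈ Q, (q : V) ∈ R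
    · rcases hsep (Subtype.val '' Q) (by rintro _ ⟨q, hq, rfl⟩; exact hQR q hq) (hQ.image _) l r
        (by
          rintro _ ⟨q, hq, rfl⟩ y hqy
          have hyU := hclosed _ (hQR q hq) y hqy
          exact (hlr q hq ⟨y, hyU⟩ (hKG hqy)).imp (fun h => ⟨_, h, rfl⟩)
            (Or.imp (congrArg Subtype.val) (congrArg Subtype.val)))
        m m.2 with ⟨m', hm', h⟩ | h | h
      exacts [hmQ (Subtype.ext h ▸ hm'), hml (Subtype.ext h), hmr (Subtype.ext h)]
    · push Not at hQR
      obtain ⟨q, hq, hqR⟩ := hQR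
      have hMR : ∀ y : U, y ∉ Q → y ≠ l → y ≠ r → (y : V) ∈ R := by
        intro y h1 h2 h3
        by_contra h
        have hqy : q ≠ y := fun h' => h1 (h' ▸ hq)
        exact hleave q hq y h1 h2 h3 ⟨hqy, hclique q y hqR h hqy⟩
      let f : U → U := fun a => if a ∈ Q then m else a
      have hf : ∀ a, a = l ∨ a = r → f a ≠ q := by
        intro a _ ha
        simp only [f] at ha
        split_ifs at ha with h
        · exact hmQ (ha ▸ hq)
        · exact h (ha ▸ hq)
      rcases hsep (Subtype.val '' {y | y ∉ Q ∧ y ≠ l ∧ y ≠ r})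
        (by rintro _ ⟨y, ⟨h1, h2, h3⟩, rfl⟩; exact hMR y h1 h2 h3)
        ⟨m, m, ⟨hmQ, hml, hmr⟩, rfl⟩ (f l) (f r)
        (by
          rintro _ ⟨y, ⟨h1, h2, h3⟩, rfl⟩ z hyz
          have hzU := hclosed _ (hMR y h1 h2 h3) z hyz
          have hzQ : (⟨z, hzU⟩ : U) ∉ Q := fun h => hleave _ h y h1 h2 h3 (hKG hyz.symm)
          by_cases hzl : (⟨z, hzU⟩ : U) = l
          · rw [← hzl]
            simp [f, hzQ]
          by_cases hzr : (⟨z, hzU⟩ : U) = r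
          · rw [← hzr]
            simp [f, hzQ]
          exact Or.inl ⟨_, ⟨hzQ, hzl, hzr⟩, rfl⟩)
        q q.2 with ⟨q', ⟨h1, -⟩, h⟩ | h | h
      · exact h1 (Subtype.ext h ▸ hq)
      · exact hf l (Or.inl rfl) (Subtype.ext h.symm)
      · exact hf r (Or.inr rfl) (Subtype.ext h.symm)
  refine HasZeroCycle.lift (K := K) (w := fun e => if e = s(u, v) then (L.length : ZMod 3) else 1)
    (hasZeroCycle_of_noTwoCut hK hU ⟨huv, Or.inr rfl⟩ fun e he => if_neg he)
    (fun x y h => h.2.symm) (fun e he => if_neg he) hL hLU huv (if_pos rfl)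

lemma four_le_ncard [Finite V] {U : Set V} {x : V} (hx : x ∈ U) (hxU : ∀ y, G.Adj x y → y ∈ U)
    (hdeg : 3 ≤ (G.neighborSet x).ncard) : 4 ≤ U.ncard := by
  have h1 : insert x (G.neighborSet x) ⊆ U := by
    rintro y (rfl | hy)
    exacts [hx, hxU y hy]
  have h2 := Set.ncard_le_ncard h1 (Set.toFinite _)
  rw [Set.ncard_insert_of_notMem (G.notMem_neighborSet_self)] at h2
  omega

/-- If `Q` is inclusion-minimal among the sets that a pair of vertices separates inside the end
block `B`, then this pair is joined by a path outside `Q`. -/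
lemma connIn_compl_of_minimal {B Q : Set V} {t l r x : V} (hB : Encloses G B t t)
    (hBmin : ∀ M ⊆ B, M.Nonempty → ∀ s, Encloses G M s s → M = B)
    (hQB : Q ⊆ B) (hQ : Encloses G Q l r) (hlQ : l ∉ Q) (hlr : l ≠ r)
    (hl : ∃ q ∈ Q, G.Adj q l) (hx : x ∈ B ∨ ∃ b ∈ B, G.Adj b x) (hxQ : x ∉ Q) (hxl : x ≠ l)
    (hxr : x ≠ r) (hlt : ¬ ConnIn G Qᶜ l t) : ConnIn G Qᶜ l r := by
  by_contra hcon
  obtain ⟨q₀, hq₀, hql⟩ := hl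
  have hllQ : ConnIn G Qᶜ l l := .refl hlQ
  have hlB : l ∈ B := by
    rcases hB q₀ (hQB hq₀) l hql with h | h | h
    · exact h
    all_goals exact absurd (h ▸ hllQ) hlt
  have hsub : ∀ y, ConnIn G Qᶜ l y → y ∈ B := by
    intro y hy
    refine hy.confine.induct hlB fun a b ha _ hb hab => ?_
    rcases hB a ha b hab with h | h | h
    · exact h
    all_goals exact absurd (h ▸ hb) hlt
  have hM : ∀ y, ConnIn G Qᶜ l y → y ≠ l → False := by
    intro y hy hyl
    have := hBmin {y | ConnIn G Qᶜ l y ∧ y ≠ l} (fun z hz => hsub z hz.1) ⟨y, hy, hyl⟩ l (by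
      rintro a ⟨ha, hal⟩ b hab
      by_cases hbl : b = l
      · exact Or.inr (Or.inl hbl)
      by_cases hbQ : b ∈ Q
      · rcases hQ b hbQ a hab.symm with h | h | h
        · exact absurd h ha.right_mem
        · exact absurd h hal
        · exact absurd (h ▸ ha) hcon
      · exact Or.inl ⟨ha.step hab hbQ, hbl⟩)
    rw [← this] at hlB
    exact hlB.2 rfl
  have hQl := hBmin (insert l Q) (Set.insert_subset hlB hQB) ⟨l, Or.inl rfl⟩ r (by
    rintro a (rfl | ha) b hab
    · refine Or.inl (Or.inr ?_)
      by_contra hbQ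
      exact hM b (hllQ.step hab hbQ) hab.ne.symm
    · rcases hQ a ha b hab with h | h | h
      exacts [Or.inl (Or.inr h), Or.inl (Or.inl h), Or.inr (Or.inl h)])
  rw [← hQl] at hx
  rcases hx with (h | h) | ⟨b, rfl | hb, hbx⟩
  · exact hxl h
  · exact hxQ h
  · exact hM x (hllQ.step hbx hxQ) hxl
  · rcases hQ b hb x hbx with h | h | h
    exacts [hxQ h, hxl h, hxr h]

/-- A nonempty finite graph of minimum degree at least three has a cycle whose length is
divisible by three. -/
theorem exists_isCycle_three_dvd [Finite V] [Nonempty V]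
    (hdeg : ∀ v, 3 ≤ (G.neighborSet v).ncard) :
    ∃ (a : V) (c : G.Walk a a), c.IsCycle ∧ 3 ∣ c.length := by
  apply HasZeroCycle.exists_isCycle
  obtain ⟨B, ⟨hBne, t, hB⟩, hBmin⟩ := exists_minimal_of_wellFoundedLT
    (fun B : Set V => B.Nonempty ∧ ∃ t, Encloses G B t t)
    ⟨Set.univ, Set.univ_nonempty, Classical.arbitrary V, fun _ _ _ _ => Or.inl trivial⟩
  replace hBmin : ∀ M ⊆ B, M.Nonempty → ∀ s, Encloses G M s s → M = B :=
    fun M hM hne s hs => hM.antisymm (hBmin ⟨hne, s, hs⟩ hM)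
  obtain ⟨C, hC⟩ : ∃ C : Set V, ∀ x, x ∈ C ↔ x ∈ B ∨ ∃ b ∈ B, G.Adj b x :=
    ⟨{x | _}, fun _ => Iff.rfl⟩
  have hBt : ∀ x ∈ C, x ∈ B ∨ x = t := by
    intro x hx
    rcases (hC x).1 hx with h | ⟨b, hb, hbx⟩
    · exact Or.inl h
    · have := hB b hb x hbx
      tauto
  by_cases hsep : ∃ Q ⊆ B, Q.Nonempty ∧ ∃ l r, Encloses G Q l r ∧ ∃ x ∈ C, x ∉ Q ∧ x ≠ l ∧ x ≠ r
  · obtain ⟨Q, ⟨hQB, ⟨q₀, hq₀⟩, l, r, hQ, x, hxC, hxQ, hxl, hxr⟩, hQmin⟩ :=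
      exists_minimal_of_wellFoundedLT (fun Q : Set V => Q ⊆ B ∧ Q.Nonempty ∧
        ∃ l r, Encloses G Q l r ∧ ∃ x ∈ C, x ∉ Q ∧ x ≠ l ∧ x ≠ r) hsep
    have hone : ∀ s, Encloses G Q s s → x = s := by
      intro s hs
      have hQeq := hBmin Q hQB ⟨q₀, hq₀⟩ s hs
      rcases (hC x).1 hxC with h | ⟨b, hb, hbx⟩
      · exact absurd (hQeq ▸ h) hxQ
      · rcases hs b (hQeq ▸ hb) x hbx with h | h | h
        exacts [absurd h hxQ, h, h]
    have hnbr : ∀ l r, Encloses G Q l r → x ≠ r → l ∉ Q ∧ ∃ q ∈ Q, G.Adj q l := by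
      intro l r hQ hxr
      by_contra hcon
      refine hxr (hone r fun q hq y hqy => ?_)
      rcases hQ q hq y hqy with h | rfl | h
      · exact Or.inl h
      · by_contra! h
        exact hcon ⟨h.1, q, hq, hqy⟩
      · exact Or.inr (Or.inl h)
    have hQ' : Encloses G Q r l := fun q hq y hqy => (hQ q hq y hqy).imp id Or.symm
    obtain ⟨hlQ, hl⟩ := hnbr l r hQ hxr
    obtain ⟨hrQ, hr⟩ := hnbr r l hQ' hxl
    have hlr : l ≠ r := by
      rintro rfl
      exact hxl (hone _ hQ)
    have hconn : ConnIn G Qᶜ l r := by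
      by_cases hlt : ConnIn G Qᶜ l t
      · by_cases hrt : ConnIn G Qᶜ r t
        · exact hlt.trans hrt.symm
        · exact (connIn_compl_of_minimal hB hBmin hQB hQ' hrQ hlr.symm hr ((hC x).1 hxC) hxQ
            hxr hxl hrt).symm
      · exact connIn_compl_of_minimal hB hBmin hQB hQ hlQ hlr hl ((hC x).1 hxC) hxQ hxl hxr hlt
    obtain ⟨-, -, L, hL, hLQ, -⟩ := hconn.exists_pathIn (w := fun _ => 1)
    have hUC : ∀ y ∈ insert l (insert r Q), y ∈ C := by
      rintro y (rfl | rfl | hy)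
      · exact (hC _).2 (Or.inr (hl.imp fun q h => ⟨hQB h.1, h.2⟩))
      · exact (hC _).2 (Or.inr (hr.imp fun q h => ⟨hQB h.1, h.2⟩))
      · exact (hC _).2 (Or.inl (hQB hy))
    have hclosed : ∀ q ∈ Q, ∀ y, G.Adj q y → y ∈ insert l (insert r Q) := by
      intro q hq y hqy
      rcases hQ q hq y hqy with h | h | h
      exacts [Or.inr (Or.inr h), Or.inl h, Or.inr (Or.inl h)]
    refine hasZeroCycle_of_region (R := Q) (U := insert l (insert r Q)) (L := L)
      (u := ⟨l, Or.inl rfl⟩) (v := ⟨r, Or.inr (Or.inl rfl)⟩) hclosed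
      (four_le_ncard (Or.inr (Or.inr hq₀)) (hclosed q₀ hq₀) (hdeg q₀))
      (fun h => hlr (congrArg Subtype.val h)) hL ?_ ?_ ?_
    · rintro ⟨y, rfl | rfl | hy⟩ hyL
      exacts [Or.inl rfl, Or.inr rfl, absurd hy (hLQ y hyL)]
    · rintro ⟨y, rfl | rfl | hy⟩ ⟨z, rfl | rfl | hz⟩ hyR hzR hyz
      · exact absurd rfl hyz
      · exact Or.inr rfl
      · exact absurd hz hzR
      · exact Or.inr Sym2.eq_swap
      · exact absurd rfl hyz
      · exact absurd hz hzR
      all_goals exact absurd hy hyR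
    · intro M hMQ hMne l' r' hM y hyU
      by_contra! hcon
      have hMeq : Q ⊆ M := hQmin ⟨hMQ.trans hQB, hMne, l', r', hM, y, hUC y hyU, hcon⟩ hMQ
      have hmem : ∀ s, s ∉ Q → (∃ q ∈ Q, G.Adj q s) → s = l' ∨ s = r' := by
        rintro s hs ⟨q, hq, hqs⟩
        exact (hM q (hMeq hq) s hqs).resolve_left fun h => hs (hMQ h)
      have h1 := hmem l hlQ hl
      have h2 := hmem r hrQ hr
      rcases hyU with rfl | rfl | hy
      · tauto
      · tauto
      · exact hcon.1 (hMeq hy)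
  · obtain ⟨b, hb⟩ := hBne
    obtain ⟨y, hby⟩ : (G.neighborSet b).Nonempty := by
      rw [← Set.ncard_pos]
      exact (by norm_num : 0 < 3).trans_le (hdeg b)
    have hclosed : ∀ x ∈ B, ∀ y, G.Adj x y → y ∈ C := fun x hx y hxy =>
      (hC y).2 (Or.inr ⟨x, hx, hxy⟩)
    have hbC : b ∈ C := (hC b).2 (Or.inl hb)
    refine hasZeroCycle_of_region (R := B) (U := C) (u := ⟨b, hbC⟩) (v := ⟨y, hclosed b hb y hby⟩)
      (L := Adj.toWalk hby) hclosed (four_le_ncard hbC (hclosed b hb) (hdeg b))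
      (fun h => G.ne_of_adj hby (congrArg Subtype.val h)) (Adj.isPath_toWalk hby) ?_ ?_ ?_
    · intro x hx
      replace hx : (x : V) ∈ [b, y] := hx
      simp only [List.mem_cons, List.not_mem_nil, or_false] at hx
      exact hx.imp Subtype.ext Subtype.ext
    · intro x y hx hy hxy
      exact absurd (Subtype.ext (((hBt x x.2).resolve_left hx).trans
        ((hBt y y.2).resolve_left hy).symm)) hxy
    · intro M hM hMne l r hlr x hx
      by_contra! hcon
      exact hsep ⟨M, hM, hMne, l, r, hlr, x, hx, hcon⟩

end MinDegree

section Decomposition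

variable {V : Type*} (G : SimpleGraph V) [DecidableRel G.Adj]

/-- The number of neighbours of `v` in `A`. -/
def degIn (A : Finset V) (v : V) : ℕ := (A.filter (G.Adj v)).card

/-- `A` is nonempty and induces a subgraph of minimum degree at least `s`. -/
def MinDegIn (s : ℕ) (A : Finset V) : Prop := A.Nonempty ∧ ∀ v ∈ A, s ≤ degIn G A v

variable {G} {A B U : Finset V} {s t : ℕ} {v x y : V}

lemma degIn_mono (h : A ⊆ B) : degIn G A v ≤ degIn G B v :=
  Finset.card_le_card (Finset.filter_subset_filter _ h)

lemma degIn_lt_card (hv : v ∈ A) : degIn G A v < A.card := by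
  refine Finset.card_lt_card (Finset.filter_ssubset.2 ⟨v, hv, ?_⟩)
  simp

lemma MinDegIn.mono (h : MinDegIn G t A) (hst : s ≤ t) : MinDegIn G s A :=
  ⟨h.1, fun v hv => hst.trans (h.2 v hv)⟩

lemma MinDegIn.lt_card (h : MinDegIn G s A) : s < A.card := by
  obtain ⟨v, hv⟩ := h.1
  exact (h.2 v hv).trans_lt (degIn_lt_card hv)

variable [DecidableEq V]

lemma degIn_insert (hy : y ∉ A) :
    degIn G (insert y A) v = degIn G A v + if G.Adj v y then 1 else 0 := by
  unfold degIn
  rw [Finset.filter_insert]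
  split_ifs with h
  · rw [Finset.card_insert_of_notMem (by simp [hy])]
  · simp

lemma degIn_le_erase (A : Finset V) (v x : V) :
    degIn G A v ≤ degIn G (A.erase x) v + if G.Adj v x then 1 else 0 := by
  rw [← degIn_insert (Finset.notMem_erase x A)]
  exact degIn_mono (Finset.insert_erase_subset x A)

lemma degIn_le_erase_add_one (A : Finset V) (v x : V) :
    degIn G A v ≤ degIn G (A.erase x) v + 1 := by
  have := degIn_le_erase (G := G) A v x
  split_ifs at this <;> omega

lemma degIn_union (h : Disjoint A B) : degIn G (A ∪ B) v = degIn G A v + degIn G B v := by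
  unfold degIn
  rw [Finset.filter_union, Finset.card_union_of_disjoint (Finset.disjoint_filter_filter h)]

lemma sum_degIn_insert (hy : y ∉ A) :
    ∑ v ∈ insert y A, degIn G (insert y A) v = ∑ v ∈ A, degIn G A v + 2 * degIn G A y := by
  rw [Finset.sum_insert hy, Finset.sum_congr rfl fun v _ => degIn_insert (G := G) (v := v) hy,
    Finset.sum_add_distrib, degIn_insert hy, ← Finset.card_filter]
  have : (A.filter fun v => G.Adj v y).card = degIn G A y := by
    simp only [degIn, G.adj_comm]
  rw [this]
  simp
  ring

lemma MinDegIn.erase (h : MinDegIn G (s + 1) A) (x : V) : MinDegIn G s (A.erase x) := by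
  refine ⟨?_, fun v hv => ?_⟩
  · have := Finset.pred_card_le_card_erase (s := A) (a := x)
    have := h.lt_card
    rw [← Finset.card_pos]
    omega
  · have := h.2 v (Finset.mem_of_mem_erase hv)
    have := degIn_le_erase_add_one (G := G) A v x
    omega

/-- The weight function maximised in the proof of `exists_disjoint_minDegIn`. -/
def cutWeight (G : SimpleGraph V) [DecidableRel G.Adj] (s t : ℕ) (A B : Finset V) : ℤ :=
  ((∑ v ∈ A, degIn G A v : ℕ) : ℤ) + ((∑ v ∈ B, degIn G B v : ℕ) : ℤ) + 2 * (t - s - 1) * A.card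

/-- A triangle-free graph of minimum degree `s + t` contains disjoint subgraphs of minimum degrees
`s` and `t`. -/
theorem exists_disjoint_minDegIn (hs : 1 ≤ s) (ht : 1 ≤ t) (hU : MinDegIn G (s + t) U)
    (hfree : ∀ x ∈ U, ∀ y ∈ U, ∀ z ∈ U, G.Adj x y → G.Adj y z → ¬ G.Adj x z) :
    ∃ A ⊆ U, ∃ B ⊆ U, Disjoint A B ∧ MinDegIn G s A ∧ MinDegIn G t B := by
  classical
  by_contra! hcon
  let P : Finset V → Prop := fun A => A ⊆ U ∧ (∀ A' ⊆ A, ¬ MinDegIn G (s + 1) A') ∧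
    ∀ B ⊆ U \ A, ¬ MinDegIn G t B
  obtain ⟨A, hA, hmax⟩ : ∃ A, P A ∧ ∀ A', P A' →
      cutWeight G s t A' (U \ A') ≤ cutWeight G s t A (U \ A) := by
    have hne : (U.powerset.filter P).Nonempty := by
      obtain ⟨A, ⟨hAU, hA⟩, hmin⟩ := exists_minimal_of_wellFoundedLT
        (fun A => A ⊆ U ∧ MinDegIn G s A) ⟨U, subset_rfl, hU.mono (by omega)⟩
      refine ⟨A, Finset.mem_filter.2 ⟨Finset.mem_powerset.2 hAU, hAU, fun A' hA' h => ?_,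
        fun B hB => hcon A hAU B (hB.trans Finset.sdiff_subset)
          (Finset.disjoint_of_subset_right hB Finset.disjoint_sdiff) hA⟩⟩
      obtain ⟨x, hx⟩ := h.1
      exact Finset.notMem_erase x A' (hmin ⟨((Finset.erase_subset _ _).trans hA').trans hAU,
        h.erase x⟩ ((Finset.erase_subset _ _).trans hA') (hA' hx))
    obtain ⟨A, hA, hmax⟩ := Finset.exists_max_image _ (fun A => cutWeight G s t A (U \ A)) hne
    exact ⟨A, (Finset.mem_filter.1 hA).2, fun A' hA' =>
      hmax A' (Finset.mem_filter.2 ⟨Finset.mem_powerset.2 hA'.1, hA'⟩)⟩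
  obtain ⟨hAU, hA1, hA2⟩ := hA
  obtain ⟨B, hB⟩ : ∃ B, B = U \ A := ⟨_, rfl⟩
  rw [← hB] at hA2 hmax
  have hBU : B ⊆ U := hB ▸ Finset.sdiff_subset
  have hAB : Disjoint A B := hB ▸ Finset.disjoint_sdiff
  have hUAB : U = A ∪ B := by rw [hB, Finset.union_sdiff_of_subset hAU]
  have hdeg : ∀ v ∈ U, s + t ≤ degIn G A v + degIn G B v := by
    intro v hv
    rw [← degIn_union hAB, ← hUAB]
    exact hU.2 v hv
  obtain ⟨x, hxA, hx⟩ : ∃ x ∈ A, degIn G A x < s + 1 := by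
    have := hA1 A subset_rfl
    by_contra! h
    refine this ⟨?_, h⟩
    rw [Finset.nonempty_iff_ne_empty]
    rintro rfl
    rw [Finset.empty_union] at hUAB
    exact hA2 B subset_rfl (hUAB ▸ hU.mono (by omega))
  obtain ⟨y, hyB, hy⟩ : ∃ y ∈ B, degIn G B y < t := by
    have := hA2 B subset_rfl
    by_contra! h
    refine this ⟨?_, h⟩
    rw [Finset.nonempty_iff_ne_empty]
    rintro rfl
    rw [Finset.union_empty] at hUAB
    exact hA1 A subset_rfl (hUAB ▸ hU.mono (by omega))
  have hxB : x ∉ B := Finset.disjoint_left.1 hAB hxA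
  have hyA : y ∉ A := Finset.disjoint_right.1 hAB hyB
  have hxd := hdeg x (hAU hxA)
  have hyd := hdeg y (hBU hyB)
  obtain ⟨D, hD, hDt⟩ : ∃ D ⊆ insert x B, MinDegIn G t D := by
    by_contra! h
    have hUx : U \ A.erase x = insert x B := by
      rw [hB, Finset.sdiff_erase (hAU hxA)]
    have := hmax (A.erase x) ⟨(Finset.erase_subset _ _).trans hAU,
      fun A' hA' => hA1 A' (hA'.trans (Finset.erase_subset _ _)), fun D hD => h D (hUx ▸ hD)⟩
    have hc : A.card = (A.erase x).card + 1 := (Finset.card_erase_add_one hxA).symm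
    have hsum := sum_degIn_insert (G := G) (Finset.notMem_erase x A)
    have h0 := degIn_insert (G := G) (v := x) (Finset.notMem_erase x A)
    rw [Finset.insert_erase hxA] at hsum h0
    simp only [G.irrefl, if_false, add_zero] at h0
    rw [← h0] at hsum
    rw [hUx, cutWeight, cutWeight, sum_degIn_insert hxB, hsum, hc] at this
    push_cast at this
    have h1 : (degIn G A x : ℤ) ≤ s := by omega
    have h2 : (t : ℤ) ≤ degIn G B x := by omega
    linarith
  obtain ⟨C, hC, hCs⟩ : ∃ C ⊆ insert y A, MinDegIn G (s + 1) C := by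
    by_contra! h
    have hUy : U \ insert y A = B.erase y := by
      rw [hB, Finset.sdiff_insert]
    have := hmax (insert y A) ⟨Finset.insert_subset (hBU hyB) hAU, h,
      fun D hD => hA2 D ((hUy ▸ hD).trans (Finset.erase_subset _ _))⟩
    have hc : (insert y A).card = A.card + 1 := Finset.card_insert_of_notMem hyA
    have hsum := sum_degIn_insert (G := G) (Finset.notMem_erase y B)
    have h0 := degIn_insert (G := G) (v := y) (Finset.notMem_erase y B)
    rw [Finset.insert_erase hyB] at hsum h0
    simp only [G.irrefl, if_false, add_zero] at h0
    rw [← h0] at hsum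
    rw [hUy, cutWeight, cutWeight, sum_degIn_insert hyA, hsum, hc] at this
    push_cast at this
    have h1 : (degIn G B y : ℤ) ≤ t - 1 := by omega
    have h2 : (s : ℤ) + 1 ≤ degIn G A y := by omega
    linarith
  have hDU : D ⊆ U := hD.trans (Finset.insert_subset (hAU hxA) hBU)
  have hCU : C ⊆ U := hC.trans (Finset.insert_subset (hBU hyB) hAU)
  have hCD : ∀ z ∈ C, z ∈ D → z = x ∨ z = y := by
    intro z hzC hzD
    rcases Finset.mem_insert.1 (hC hzC) with h | h
    · exact Or.inr h
    · rcases Finset.mem_insert.1 (hD hzD) with h' | h'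
      · exact Or.inl h'
      · exact absurd h' (Finset.disjoint_left.1 hAB h)
  by_cases hyD : y ∈ D
  · have hxy : G.Adj y x := by
      by_contra h
      have h1 := hDt.2 y hyD
      have h2 := degIn_mono (G := G) (v := y) hD
      rw [degIn_insert hxB, if_neg h] at h2
      omega
    refine hcon ((C.erase x).erase y)
      (((Finset.erase_subset _ _).trans (Finset.erase_subset _ _)).trans hCU) D hDU ?_
      ⟨?_, fun v hv => ?_⟩ hDt
    · rw [Finset.disjoint_left]
      intro z hz hzD
      simp only [Finset.mem_erase] at hz
      rcases hCD z hz.2.2 hzD with h | h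
      exacts [hz.2.1 h, hz.1 h]
    · have h1 := hCs.lt_card
      have h2 := Finset.pred_card_le_card_erase (s := C) (a := x)
      have h3 := Finset.pred_card_le_card_erase (s := C.erase x) (a := y)
      rw [← Finset.card_pos]
      omega
    · have hvC := Finset.mem_of_mem_erase (Finset.mem_of_mem_erase hv)
      have h1 := hCs.2 v hvC
      have h2 := degIn_le_erase (G := G) C v x
      have h3 := degIn_le_erase (G := G) (C.erase x) v y
      have h4 : ¬ (G.Adj v y ∧ G.Adj v x) := fun h =>
        hfree v (hCU hvC) y (hBU hyB) x (hAU hxA) h.1 hxy h.2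
      split_ifs at h2 h3 <;> first | omega | tauto
  · refine hcon (C.erase x) ((Finset.erase_subset _ _).trans hCU) D hDU ?_ (hCs.erase x) hDt
    rw [Finset.disjoint_left]
    intro z hz hzD
    rw [Finset.mem_erase] at hz
    rcases hCD z hz.2 hzD with h | h
    exacts [hz.1 h, hyD (h ▸ hzD)]

end Decomposition

section Packing

variable {V : Type*}

/-- `U` contains `k` vertex-disjoint cycles of `G` of length divisible by three. -/
def HasCycles (G : SimpleGraph V) (k : ℕ) (U : Finset V) : Prop :=
  ∃ W : Fin k → (v : V) × G.Walk v v, (∀ i, (W i).2.IsCycle ∧ 3 ∣ (W i).2.length) ∧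
    (∀ i j, i ≠ j → ∀ x, x ∈ (W i).2.support → x ∉ (W j).2.support) ∧
    ∀ i, ∀ x ∈ (W i).2.support, x ∈ U

variable {G : SimpleGraph V} {k : ℕ} {A B U : Finset V}

lemma hasCycles_one {a : V} {c : G.Walk a a} (hc : c.IsCycle) (h3 : 3 ∣ c.length)
    (hU : ∀ x ∈ c.support, x ∈ U) : HasCycles G 1 U :=
  ⟨fun _ => ⟨a, c⟩, fun _ => ⟨hc, h3⟩, fun i j h => absurd (Subsingleton.elim i j) h, fun _ => hU⟩

lemma HasCycles.succ (hA : HasCycles G 1 A) (hB : HasCycles G k B) (hAB : Disjoint A B)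
    (hAU : A ⊆ U) (hBU : B ⊆ U) : HasCycles G (k + 1) U := by
  obtain ⟨W, hW, -, hWA⟩ := hA
  obtain ⟨W', hW', hdis, hWB⟩ := hB
  refine ⟨Fin.cons (W 0) W', ?_, ?_, ?_⟩
  · intro i
    refine Fin.cases ?_ (fun i => ?_) i
    exacts [hW 0, hW' i]
  · intro i j
    refine Fin.cases (Fin.cases ?_ fun j => ?_) (fun i => Fin.cases ?_ fun j => ?_) i j
    · exact fun h => absurd rfl h
    · exact fun _ x hx hx' => Finset.disjoint_left.1 hAB (hWA 0 x hx) (hWB j x hx')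
    · exact fun _ x hx hx' => Finset.disjoint_left.1 hAB (hWA 0 x hx') (hWB i x hx)
    · exact fun h => hdis i j fun h' => h (congrArg Fin.succ h')
  · intro i
    refine Fin.cases ?_ (fun i => ?_) i
    exacts [fun x hx => hAU (hWA 0 x hx), fun x hx => hBU (hWB i x hx)]

lemma hasCycles_one_triangle [DecidableEq V] {x y z : V} (hxy : G.Adj x y) (hyz : G.Adj y z)
    (hxz : G.Adj x z) : HasCycles G 1 {x, y, z} := by
  refine hasCycles_one (c := .cons hxy (.cons hyz (.cons hxz.symm .nil))) ?_ (by simp) ?_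
  · have h1 := hxy.ne
    have h2 := hyz.ne
    have h3 := hxz.ne
    simp [Walk.cons_isCycle_iff, h1, h2, h3, h1.symm, h3.symm]
  · intro t ht
    simp only [Walk.support_cons, Walk.support_nil, List.mem_cons, List.not_mem_nil] at ht
    simp only [Finset.mem_insert, Finset.mem_singleton]
    tauto

lemma hasCycles_one_of_minDegIn [DecidableRel G.Adj] (hU : MinDegIn G 3 U) :
    HasCycles G 1 U := by
  have : Nonempty (U : Set V) := hU.1.coe_sort
  obtain ⟨a, c, hc, h3⟩ := exists_isCycle_three_dvd (G := G.induce (U : Set V)) fun v => by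
    refine (hU.2 v v.2).trans ?_
    have h : Subtype.val '' ((G.induce (U : Set V)).neighborSet v) = ↑(U.filter (G.Adj v)) := by
      ext y
      simp [and_comm]
    rw [← Set.ncard_image_of_injective _ Subtype.val_injective, h, Set.ncard_coe_finset]
    rfl
  refine hasCycles_one (hc.map (f := (Embedding.induce (U : Set V)).toHom)
    Subtype.val_injective) ((c.length_map _).symm ▸ h3) fun x hx => ?_
  rw [Walk.support_map, List.mem_map] at hx
  obtain ⟨y, -, rfl⟩ := hx
  exact y.2

theorem hasCycles_of_minDegIn [DecidableEq V] [DecidableRel G.Adj] (hk : 1 ≤ k)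
    (hU : MinDegIn G (3 * k) U) : HasCycles G k U := by
  induction k, hk using Nat.le_induction generalizing U with
  | base => exact hasCycles_one_of_minDegIn hU
  | succ k hk ih =>
    by_cases hfree : ∀ x ∈ U, ∀ y ∈ U, ∀ z ∈ U, G.Adj x y → G.Adj y z → ¬ G.Adj x z
    · obtain ⟨A, hAU, B, hBU, hAB, hA, hB⟩ := exists_disjoint_minDegIn (s := 3) (t := 3 * k)
        (by omega) (by omega) (hU.mono (by omega)) hfree
      exact (hasCycles_one_of_minDegIn hA).succ (ih hB) hAB hAU hBU
    · push Not at hfree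
      obtain ⟨x, hx, y, hy, z, hz, hxy, hyz, hxz⟩ := hfree
      refine (hasCycles_one_triangle hxy hyz hxz).succ (B := ((U.erase x).erase y).erase z)
        (ih (((hU.mono (by omega : 3 * k + 1 + 1 + 1 ≤ 3 * (k + 1))).erase x).erase y |>.erase z))
        ?_ ?_ ?_
      · rw [Finset.disjoint_left]
        intro t ht
        simp only [Finset.mem_insert, Finset.mem_singleton] at ht
        simp only [Finset.mem_erase]
        tauto
      · intro t ht
        simp only [Finset.mem_insert, Finset.mem_singleton] at ht
        rcases ht with rfl | rfl | rfl <;> assumption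
      · exact (Finset.erase_subset _ _).trans
          ((Finset.erase_subset _ _).trans (Finset.erase_subset _ _))

end Packing

end CyclesModThree

theorem stmt_15 {V : Type*} [Fintype V] [DecidableEq V] [Nonempty V]
    (G : SimpleGraph V) [DecidableRel G.Adj] (k : ℕ) (hk : 1 ≤ k)
    (hδ : ∀ v : V, 3 * k ≤ G.degree v) :
    ∃ W : Fin k → (v : V) × G.Walk v v,
      (∀ i, (W i).2.IsCycle ∧ 3 ∣ (W i).2.length) ∧
      (∀ i j, i ≠ j → ∀ x, x ∈ (W i).2.support → x ∉ (W j).2.support) := by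
  have hU : CyclesModThree.MinDegIn G (3 * k) Finset.univ := by
    refine ⟨Finset.univ_nonempty, fun v _ => (hδ v).trans_eq ?_⟩
    rw [← G.card_neighborFinset_eq_degree, G.neighborFinset_eq_filter]
    rfl
  obtain ⟨W, h1, h2, -⟩ := CyclesModThree.hasCycles_of_minDegIn hk hU
  exact ⟨W, h1, h2⟩
end

section
/- Let c ≥ 2 and k ≥ 1 be integers. Assuming that every graph with minimum degree at least c contains a cycle with (c+1)(c−2)/2 chords, it follows that every graph G with δ(G) ≥ (c+1)k − 1 contains k pairwise vertex-disjoint cycles each having (c+1)(c−2)/2 chords. -/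
/-- `G` contains `k` pairwise vertex-disjoint cycles, each having `c` chords
(edges of `G` joining non-consecutive vertices of the cycle). -/
def HasDisjointChordedCycles {V : Type*} (G : SimpleGraph V) (k c : ℕ) : Prop :=
  ∃ W : Fin k → (v : V) × G.Walk v v,
    (∀ i, (W i).2.IsCycle) ∧
    (∀ i, ∃ chords : Finset (Sym2 V), chords.card = c ∧
      ∀ e ∈ chords, e ∈ G.edgeSet ∧ e ∉ (W i).2.edges ∧ ∀ x ∈ e, x ∈ (W i).2.support) ∧
    (∀ i j, i ≠ j → ∀ x, x ∈ (W i).2.support → x ∉ (W j).2.support)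

namespace SimpleGraph

variable {V : Type*} (G : SimpleGraph V) [DecidableRel G.Adj]

/-- The number of neighbours of `x` in `S`. -/
def degreeIn (S : Finset V) (x : V) : ℕ := (S.filter (G.Adj x)).card

/-- Every nonempty subset `T` of `S` has a vertex with at most `a` neighbours in `T`. -/
def IsDegenerateOn (a : ℕ) (S : Finset V) : Prop :=
  ∀ T ⊆ S, T.Nonempty → ∃ x ∈ T, G.degreeIn T x ≤ a

/-- The potential maximised in the proof of Stiebitz's theorem. -/
def partitionWeight (a b : ℕ) (A B : Finset V) : ℕ :=
  ∑ z ∈ A, G.degreeIn A z + ∑ z ∈ B, G.degreeIn B z + 2 * b * A.card + 2 * a * B.card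

variable {G}

theorem IsDegenerateOn.mono {a : ℕ} {S T : Finset V} (h : G.IsDegenerateOn a T) (hST : S ⊆ T) :
    G.IsDegenerateOn a S :=
  fun R hR => h R (hR.trans hST)

theorem partitionWeight_comm (a b : ℕ) (A B : Finset V) :
    G.partitionWeight a b A B = G.partitionWeight b a B A := by
  unfold partitionWeight
  ring

theorem degree_induce_eq_degreeIn (S : Finset V) (x : S) :
    (G.induce (S : Set V)).degree x = G.degreeIn S x := by
  rw [← card_neighborFinset_eq_degree, degreeIn,
    ← Finset.card_map (Function.Embedding.subtype (· ∈ S))]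
  congr 1
  ext z
  simp [and_comm]

variable [DecidableEq V]

theorem degreeIn_insert {S : Finset V} {x : V} (hx : x ∉ S) (z : V) :
    G.degreeIn (insert x S) z = G.degreeIn S z + if G.Adj z x then 1 else 0 := by
  unfold degreeIn
  rw [Finset.filter_insert]
  split_ifs
  · rw [Finset.card_insert_of_notMem (by simp [hx])]
  · rfl

theorem degreeIn_le_erase_add_one (S : Finset V) (x z : V) :
    G.degreeIn S z ≤ G.degreeIn (S.erase x) z + 1 := by
  unfold degreeIn
  rw [Finset.filter_erase]
  exact Nat.sub_le_iff_le_add.1 Finset.pred_card_le_card_erase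

theorem degreeIn_insert_self (S : Finset V) (x : V) :
    G.degreeIn (insert x S) x = G.degreeIn S x := by
  simp [degreeIn, Finset.filter_insert]

theorem degreeIn_add_degreeIn_sdiff {S U : Finset V} (h : S ⊆ U) (x : V) :
    G.degreeIn S x + G.degreeIn (U \ S) x = G.degreeIn U x := by
  unfold degreeIn
  rw [← Finset.card_union_of_disjoint
    (Finset.disjoint_filter_filter Finset.disjoint_sdiff), ← Finset.filter_union,
    Finset.union_sdiff_of_subset h]

theorem sum_degreeIn_insert {S : Finset V} {x : V} (hx : x ∉ S) :
    ∑ z ∈ insert x S, G.degreeIn (insert x S) z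
      = ∑ z ∈ S, G.degreeIn S z + 2 * G.degreeIn S x := by
  rw [Finset.sum_insert hx, degreeIn_insert_self,
    Finset.sum_congr rfl fun z _ => degreeIn_insert hx z, Finset.sum_add_distrib,
    ← Finset.card_filter]
  simp only [G.adj_comm _ x]
  change _ + (_ + G.degreeIn S x) = _
  ring

/-- A minimal nonempty subset inducing minimum degree at least `a` is degenerate. -/
theorem exists_isDegenerateOn (a : ℕ) {U : Finset V} (hU : U.Nonempty)
    (h : ∀ x ∈ U, a ≤ G.degreeIn U x) :
    ∃ A ⊆ U, A.Nonempty ∧ (∀ x ∈ A, a ≤ G.degreeIn A x) ∧ G.IsDegenerateOn a A := by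
  obtain ⟨A, hAU, ⟨hA, hdeg⟩, hmin⟩ := exists_minimal_le_of_wellFoundedLT
    (fun A : Finset V => A.Nonempty ∧ ∀ x ∈ A, a ≤ G.degreeIn A x) U ⟨hU, h⟩
  refine ⟨A, hAU, hA, hdeg, fun T hT hTne => ?_⟩
  by_contra! hlt
  obtain ⟨y, hy⟩ := hTne
  have hdegT : ∀ x ∈ T.erase y, a ≤ G.degreeIn (T.erase y) x := fun x hx => by
    have := hlt x (Finset.mem_of_mem_erase hx)
    have := degreeIn_le_erase_add_one (G := G) T y x
    omega
  have hne : (T.erase y).Nonempty := by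
    obtain ⟨z, hz⟩ := Finset.card_pos.1 ((Nat.zero_le a).trans_lt (hlt y hy))
    rw [Finset.mem_filter] at hz
    exact ⟨z, Finset.mem_erase.2 ⟨hz.2.ne', hz.1⟩⟩
  exact Finset.notMem_erase y T (hmin ⟨hne, hdegT⟩ ((Finset.erase_subset _ _).trans hT) (hT hy))

/-- If adding `y` to a degenerate set destroys degeneracy, the enlarged set contains a subset
through `y` of large minimum degree. -/
theorem IsDegenerateOn.exists_of_not_insert {a : ℕ} {S : Finset V} {y : V}
    (h : G.IsDegenerateOn a S) (hy : ¬ G.IsDegenerateOn a (insert y S)) :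
    ∃ T ⊆ insert y S, y ∈ T ∧ ∀ z ∈ T, a + 1 ≤ G.degreeIn T z := by
  unfold IsDegenerateOn at hy
  push Not at hy
  obtain ⟨T, hT, hTne, hdeg⟩ := hy
  refine ⟨T, hT, ?_, hdeg⟩
  by_contra hyT
  obtain ⟨x, hx, hle⟩ := h T ((Finset.subset_insert_iff_of_notMem hyT).1 hT) hTne
  exact (hdeg x hx).not_ge hle

theorem partitionWeight_lt_of_move {a b : ℕ} {A B : Finset V} {x : V} (hxA : x ∈ A) (hxB : x ∉ B)
    (hA : G.degreeIn A x ≤ a) (hB : b + 1 ≤ G.degreeIn B x) :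
    G.partitionWeight a b A B < G.partitionWeight a b (A.erase x) (insert x B) := by
  obtain ⟨S, hxS, rfl⟩ : ∃ S, x ∉ S ∧ insert x S = A :=
    ⟨A.erase x, Finset.notMem_erase _ _, Finset.insert_erase hxA⟩
  rw [degreeIn_insert_self] at hA
  unfold partitionWeight
  rw [Finset.erase_insert hxS, sum_degreeIn_insert hxS, sum_degreeIn_insert hxB,
    Finset.card_insert_of_notMem hxS, Finset.card_insert_of_notMem hxB]
  linarith

/-- **Stiebitz's theorem**, as a statement about disjoint vertex sets. -/
theorem exists_disjoint_of_add_add_one_le_degreeIn (a b : ℕ) {U : Finset V} (hU : U.Nonempty)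
    (h : ∀ x ∈ U, a + b + 1 ≤ G.degreeIn U x) :
    ∃ A ⊆ U, ∃ B ⊆ U, Disjoint A B ∧ A.Nonempty ∧ B.Nonempty ∧
      (∀ x ∈ A, a ≤ G.degreeIn A x) ∧ ∀ x ∈ B, b ≤ G.degreeIn B x := by
  obtain ⟨A₀, hA₀U, hA₀, hdeg₀, hdegen₀⟩ :=
    exists_isDegenerateOn a hU fun x hx => le_trans (by omega) (h x hx)
  by_cases hB₀ : G.IsDegenerateOn b (U \ A₀)
  swap
  · unfold IsDegenerateOn at hB₀
    push Not at hB₀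
    obtain ⟨B, hB, hBne, hdeg⟩ := hB₀
    exact ⟨A₀, hA₀U, B, hB.trans Finset.sdiff_subset,
      Finset.disjoint_sdiff.mono_right hB, hA₀, hBne, hdeg₀, fun x hx => (hdeg x hx).le⟩
  classical
  obtain ⟨A, hAmem, hmax⟩ := Finset.exists_max_image
    (U.powerset.filter fun A => G.IsDegenerateOn a A ∧ G.IsDegenerateOn b (U \ A))
    (fun A => G.partitionWeight a b A (U \ A))
    ⟨A₀, by simp [hA₀U, hdegen₀, hB₀]⟩
  simp only [Finset.mem_filter, Finset.mem_powerset] at hAmem hmax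
  obtain ⟨hAU, hAdeg, hBdeg⟩ := hAmem
  have hAne : A.Nonempty := by
    by_contra! he
    subst he
    obtain ⟨x, hx, hle⟩ := hBdeg U (by simp) hU
    have := h x hx
    omega
  have hBne : (U \ A).Nonempty := by
    by_contra! he
    obtain ⟨x, hx, hle⟩ := hAdeg U (Finset.sdiff_eq_empty_iff_subset.1 he) hU
    have := h x hx
    omega
  obtain ⟨x, hxA, hxa⟩ := hAdeg A subset_rfl hAne
  obtain ⟨y, hyB, hyb⟩ := hBdeg _ subset_rfl hBne
  obtain ⟨hyU, hyA⟩ := Finset.mem_sdiff.1 hyB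
  have hxU := hAU hxA
  have hxB : x ∉ U \ A := fun hx => (Finset.mem_sdiff.1 hx).2 hxA
  have hxy : x ≠ y := fun e => hyA (e ▸ hxA)
  have hxsum := degreeIn_add_degreeIn_sdiff (G := G) hAU x
  have hysum := degreeIn_add_degreeIn_sdiff (G := G) hAU y
  have hx := h x hxU
  have hy := h y hyU
  have hBx : ¬ G.IsDegenerateOn b (insert x (U \ A)) := fun hd => by
    have he : U \ A.erase x = insert x (U \ A) := Finset.sdiff_erase hxU
    have hle := hmax (A.erase x)
      ⟨(Finset.erase_subset _ _).trans hAU, hAdeg.mono (Finset.erase_subset _ _), he ▸ hd⟩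
    rw [he] at hle
    exact hle.not_gt (partitionWeight_lt_of_move hxA hxB hxa (by omega))
  have hAy : ¬ G.IsDegenerateOn a (insert y A) := fun hd => by
    have he : U \ insert y A = (U \ A).erase y := Finset.sdiff_insert U A y
    have hle := hmax (insert y A)
      ⟨Finset.insert_subset hyU hAU, hd, he ▸ hBdeg.mono (Finset.erase_subset _ _)⟩
    rw [he, partitionWeight_comm a b A, partitionWeight_comm a b (insert y A)] at hle
    exact hle.not_gt (partitionWeight_lt_of_move hyB hyA hyb (by omega))
  obtain ⟨A', hA'sub, hyA', hA'⟩ := hAdeg.exists_of_not_insert hAy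
  obtain ⟨B', hB'sub, hxB', hB'⟩ := hBdeg.exists_of_not_insert hBx
  refine ⟨A'.erase x, ?_, B'.erase y, ?_, ?_, ⟨y, Finset.mem_erase.2 ⟨hxy.symm, hyA'⟩⟩,
    ⟨x, Finset.mem_erase.2 ⟨hxy, hxB'⟩⟩, fun z hz => ?_, fun z hz => ?_⟩
  · exact (Finset.erase_subset _ _).trans (hA'sub.trans (Finset.insert_subset hyU hAU))
  · exact (Finset.erase_subset _ _).trans
      (hB'sub.trans (Finset.insert_subset hxU Finset.sdiff_subset))
  · rw [Finset.disjoint_left]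
    intro z hzA hzB
    obtain ⟨hzx, hzA'⟩ := Finset.mem_erase.1 hzA
    obtain ⟨hzy, hzB'⟩ := Finset.mem_erase.1 hzB
    have h1 := (Finset.mem_insert.1 (hA'sub hzA')).resolve_left hzy
    have h2 := (Finset.mem_insert.1 (hB'sub hzB')).resolve_left hzx
    exact (Finset.mem_sdiff.1 h2).2 h1
  · have := hA' z (Finset.mem_of_mem_erase hz)
    have := degreeIn_le_erase_add_one (G := G) A' x z
    omega
  · have := hB' z (Finset.mem_of_mem_erase hz)
    have := degreeIn_le_erase_add_one (G := G) B' y z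
    omega

theorem exists_pairwise_disjoint_of_le_degreeIn (c k : ℕ) {U : Finset V} (hU : U.Nonempty)
    (h : ∀ x ∈ U, (c + 1) * (k + 1) - 1 ≤ G.degreeIn U x) :
    ∃ f : Fin (k + 1) → Finset V, (∀ i, f i ⊆ U) ∧ Pairwise (Function.onFun Disjoint f) ∧
      (∀ i, (f i).Nonempty) ∧ ∀ i, ∀ x ∈ f i, c ≤ G.degreeIn (f i) x := by
  induction k generalizing U with
  | zero =>
    exact ⟨fun _ => U, fun _ => subset_rfl,
      fun i j hij => (hij (Subsingleton.elim (α := Fin 1) i j)).elim,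
      fun _ => hU, fun _ x hx => by simpa using h x hx⟩
  | succ k ih =>
    obtain ⟨A, hAU, B, hBU, hAB, hA, hB, hAdeg, hBdeg⟩ :=
      exists_disjoint_of_add_add_one_le_degreeIn (G := G) c ((c + 1) * (k + 1) - 1) hU
        fun x hx => by
        have h1 := h x hx
        have h2 : (c + 1) * (k + 1 + 1) = (c + 1) * (k + 1) + (c + 1) := by ring
        have h3 : 0 < (c + 1) * (k + 1) := by positivity
        omega
    obtain ⟨f, hfB, hdisj, hne, hdeg⟩ := ih hB hBdeg
    refine ⟨Fin.cons A f, Fin.cases hAU fun i => (hfB i).trans hBU, ?_, Fin.cases hA hne,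
      Fin.cases hAdeg hdeg⟩
    intro i j hij
    induction i using Fin.cases with
    | zero =>
      induction j using Fin.cases with
      | zero => exact (hij rfl).elim
      | succ j => exact hAB.mono_right (hfB j)
    | succ i =>
      induction j using Fin.cases with
      | zero => exact (hAB.mono_right (hfB i)).symm
      | succ j => exact hdisj fun e => hij (congrArg Fin.succ e)

end SimpleGraph

/-- A chorded cycle of an induced subgraph is a chorded cycle of the whole graph. -/
theorem HasDisjointChordedCycles.exists_of_induce {V : Type*} {G : SimpleGraph V} {S : Set V}
    {c : ℕ} (h : HasDisjointChordedCycles (G.induce S) 1 c) :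
    ∃ W : (v : V) × G.Walk v v, W.2.IsCycle ∧
      (∃ chords : Finset (Sym2 V), chords.card = c ∧
        ∀ e ∈ chords, e ∈ G.edgeSet ∧ e ∉ W.2.edges ∧ ∀ x ∈ e, x ∈ W.2.support) ∧
      ∀ x ∈ W.2.support, x ∈ S := by
  obtain ⟨W, hcyc, hch, -⟩ := h
  obtain ⟨chords, hcard, hchords⟩ := hch 0
  let φ := SimpleGraph.Embedding.induce (G := G) S
  have hinj : Function.Injective (Sym2.map φ) := Sym2.map.injective φ.injective
  refine ⟨⟨_, (W 0).2.map φ.toHom⟩, (hcyc 0).map φ.injective,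
    ⟨chords.map ⟨_, hinj⟩, by simpa using hcard, ?_⟩, ?_⟩
  · simp only [Finset.mem_map, Function.Embedding.coeFn_mk]
    rintro _ ⟨e, he, rfl⟩
    obtain ⟨h1, h2, h3⟩ := hchords e he
    refine ⟨φ.toHom.map_mem_edgeSet h1, ?_, ?_⟩
    · rw [SimpleGraph.Walk.edges_map]
      exact fun hm => h2 ((List.mem_map_of_injective hinj).1 hm)
    · intro x hx
      obtain ⟨y, hy, rfl⟩ := Sym2.mem_map.1 hx
      rw [SimpleGraph.Walk.support_map]
      exact List.mem_map_of_mem (h3 y hy)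
  · intro x hx
    rw [SimpleGraph.Walk.support_map] at hx
    obtain ⟨y, -, rfl⟩ := List.mem_map.1 hx
    exact y.2

theorem stmt_17 (c k : ℕ) (hc : 2 ≤ c) (hk : 1 ≤ k)
    (hbase : ∀ (W : Type) [Fintype W] [DecidableEq W] [Nonempty W]
      (H : SimpleGraph W) [DecidableRel H.Adj],
      (∀ v : W, c ≤ H.degree v) → HasDisjointChordedCycles H 1 ((c + 1) * (c - 2) / 2))
    {V : Type} [Fintype V] [DecidableEq V] [Nonempty V]
    (G : SimpleGraph V) [DecidableRel G.Adj]
    (hδ : ∀ v : V, (c + 1) * k - 1 ≤ G.degree v) :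
    HasDisjointChordedCycles G k ((c + 1) * (c - 2) / 2) := by
  obtain ⟨k, rfl⟩ : ∃ m, k = m + 1 := ⟨k - 1, by omega⟩
  obtain ⟨f, -, hdisj, hne, hdeg⟩ := SimpleGraph.exists_pairwise_disjoint_of_le_degreeIn
    (G := G) c k Finset.univ_nonempty fun x _ => by
      have hx := hδ x
      rwa [← SimpleGraph.card_neighborFinset_eq_degree,
        SimpleGraph.neighborFinset_eq_filter] at hx
  have hcycle (i : Fin (k + 1)) := by
    have := (hne i).to_subtype
    exact (hbase (f i) (G.induce (f i : Set V)) fun x =>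
      (hdeg i x x.2).trans_eq (SimpleGraph.degree_induce_eq_degreeIn (f i) x).symm).exists_of_induce
  choose W hcyc hch hsupp using hcycle
  exact ⟨W, hcyc, hch, fun i j hij x hi hj =>
    Finset.disjoint_left.1 (hdisj hij) (hsupp i x hi) (hsupp j x hj)⟩
end
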